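/- arXiv:1006.0311 — 2 statements merged into one kernel-verified Lean document; each statement's English description precedes it below -/
import Mathlib

section
/- For every integer m ≥ 1, the following identity of formal power series in ℚ[[t]] holds: ∑_{n≥0} s_n^{(m)} · t^{2n}/(n!)^2 = det( I_{i−j} )_{1≤i,j≤m}, where s_n^{(m)} denotes the number of permutations in S_n^{(m)}. -/
open scoped Classical

noncomputable section

/-- `f` has an ascending subsequence of length `k`. -/
def HasAscSeq {n : ℕ} (f : Fin n → Fin n) (k : ℕ) : Prop :=
  ∃ s : Fin k → Fin n, StrictMono s ∧ StrictMono fun a => f (s a)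

/-- The number of permutations of `{1,…,n}` with no ascending subsequence of
length `m+1`, i.e. the cardinality of `S_n^{(m)}`. -/
def permCount (m n : ℕ) : ℕ :=
  Nat.card {τ : Equiv.Perm (Fin n) // ¬ HasAscSeq (⇑τ) (m + 1)}

/-- The formal power series `I_i = ∑_{n ≥ max(0,−i)} t^{2n+i}/(n!·(n+i)!)` in `ℚ[[t]]`. -/
def besselI (i : ℤ) : PowerSeries ℚ :=
  PowerSeries.mk fun N =>
    if 0 ≤ (N : ℤ) - i ∧ 0 ≤ (N : ℤ) + i ∧ 2 ∣ ((N : ℤ) - i) then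
      1 / ((Nat.factorial (((N : ℤ) - i) / 2).toNat : ℚ) *
           (Nat.factorial (((N : ℤ) + i) / 2).toNat : ℚ))
    else 0


/-! ### Letter counts in prefixes of words -/

/-- The number of occurrences of the letter `c` among the first `x` letters of `u`, where `u` is
continued past its end by steps that increase the count of every letter by one. -/
def letterCount {m n : ℕ} (u : Fin n → Fin m) (c x : ℕ) : ℕ :=
  ∑ k ∈ Finset.range x, if h : k < n then if (u ⟨k, h⟩ : ℕ) = c then 1 else 0 else 1

section LetterCount

variable {m n : ℕ} (u : Fin n → Fin m) (c : ℕ)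

@[simp] lemma letterCount_zero : letterCount u c 0 = 0 := by simp [letterCount]

lemma letterCount_succ (x : ℕ) : letterCount u c (x + 1) =
    letterCount u c x + if h : x < n then if (u ⟨x, h⟩ : ℕ) = c then 1 else 0 else 1 :=
  Finset.sum_range_succ _ _

lemma letterCount_succ_fin (p : Fin n) : letterCount u c (p + 1) =
    letterCount u c p + if (u p : ℕ) = c then 1 else 0 := by
  rw [letterCount_succ, dif_pos p.isLt]

lemma letterCount_mono : Monotone (letterCount u c) :=
  monotone_nat_of_le_succ fun x => by rw [letterCount_succ]; exact Nat.le_add_right _ _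

lemma letterCount_succ_le (x : ℕ) : letterCount u c (x + 1) ≤ letterCount u c x + 1 := by
  rw [letterCount_succ]
  split_ifs <;> omega

lemma letterCount_of_ge {x : ℕ} (hx : n ≤ x) :
    letterCount u c x = letterCount u c n + (x - n) := by
  induction x, hx using Nat.le_induction with
  | base => simp
  | succ x hx ih => rw [letterCount_succ, ih, dif_neg (by omega)]; omega

lemma letterCount_eq_card {x : ℕ} (hx : x ≤ n) :
    letterCount u c x = (Finset.univ.filter fun p : Fin n => p.val < x ∧ (u p : ℕ) = c).card := by
  induction x with
  | zero => simp
  | succ x ih =>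
    rw [letterCount_succ, ih (by omega), dif_pos (by omega : x < n)]
    have hsplit : (Finset.univ.filter fun p : Fin n => p.val < x + 1 ∧ (u p : ℕ) = c) =
        (Finset.univ.filter fun p : Fin n => p.val < x ∧ (u p : ℕ) = c) ∪
        (Finset.univ.filter fun p : Fin n => p = ⟨x, hx⟩ ∧ (u p : ℕ) = c) := by
      ext p
      simp only [Finset.mem_filter, Finset.mem_univ, true_and, Finset.mem_union, Fin.ext_iff]
      grind
    rw [hsplit, Finset.card_union_of_disjoint]
    · congr 1
      split_ifs with h
      · symm
        rw [Finset.card_eq_one]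
        refine ⟨⟨x, hx⟩, ?_⟩
        ext p
        simp only [Finset.mem_filter, Finset.mem_univ, true_and, Finset.mem_singleton]
        exact ⟨fun hp => hp.1, fun hp => ⟨hp, by rw [hp]; exact h⟩⟩
      · symm
        rw [Finset.card_eq_zero, Finset.filter_eq_empty_iff]
        rintro p - ⟨rfl, hp⟩
        exact h hp
    · rw [Finset.disjoint_filter]
      rintro p - ⟨hp, -⟩ ⟨rfl, -⟩
      exact lt_irrefl _ hp

lemma letterCount_length :
    letterCount u c n = (Finset.univ.filter fun p : Fin n => (u p : ℕ) = c).card := by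
  rw [letterCount_eq_card u c le_rfl]
  congr 1
  ext p
  simp

end LetterCount

/-! ### The tail-swapping involution -/

/-- Exchange the letters `i` and `j` in `u` from position `x` on. -/
def tailSwap {m n : ℕ} (i j : Fin m) (x : ℕ) (u : Fin n → Fin m) : Fin n → Fin m :=
  fun p => if p.val < x then u p else Equiv.swap i j (u p)

section TailSwap

variable {m n : ℕ} (i j : Fin m) (x : ℕ) (u : Fin n → Fin m)

lemma tailSwap_tailSwap : tailSwap i j x (tailSwap i j x u) = u := by
  funext p
  simp only [tailSwap]
  split_ifs <;> simp

lemma letterCount_tailSwap_of_le (c : ℕ) {z : ℕ} (hz : z ≤ x) :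
    letterCount (tailSwap i j x u) c z = letterCount u c z := by
  refine Finset.sum_congr rfl fun k hk => ?_
  have : k < x := (Finset.mem_range.1 hk).trans_le hz
  simp [tailSwap, this]

lemma letterCount_tailSwap_of_ge (c : ℕ) {z : ℕ} (hz : x ≤ z) :
    letterCount (tailSwap i j x u) c z + letterCount u (Equiv.swap (i : ℕ) j c) x =
      letterCount u c x + letterCount u (Equiv.swap (i : ℕ) j c) z := by
  induction z, hz using Nat.le_induction with
  | base => rw [letterCount_tailSwap_of_le i j x u c le_rfl]
  | succ z hz ih =>
    rw [letterCount_succ, letterCount_succ]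
    have key : ∀ h : z < n, ((tailSwap i j x u ⟨z, h⟩ : ℕ) = c ↔
        (u ⟨z, h⟩ : ℕ) = Equiv.swap (i : ℕ) j c) := fun h => by
      rw [tailSwap, if_neg (by simpa using hz), Equiv.swap_apply_def, Equiv.swap_apply_def]
      simp only [Fin.ext_iff]
      split_ifs <;> omega
    simp only [key]
    omega

lemma letterCount_tailSwap_of_ne {c : ℕ} (hi : c ≠ i) (hj : c ≠ j) (z : ℕ) :
    letterCount (tailSwap i j x u) c z = letterCount u c z := by
  rcases le_total z x with h | h
  · exact letterCount_tailSwap_of_le i j x u c h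
  · have := letterCount_tailSwap_of_ge i j x u c h
    rw [Equiv.swap_apply_of_ne_of_ne hi hj] at this
    omega

end TailSwap

section Crossing

variable {m n : ℕ}

/-- The first `x` letters of `u` contain more letters `i + 1` than some prefix of `w` containing
at least as many letters `i` does. -/
def IsCrossing (u w : Fin n → Fin m) (i x : ℕ) : Prop :=
  ∃ y, letterCount u i x ≤ letterCount w i y ∧ letterCount w (i + 1) y < letterCount u (i + 1) x

/-- No two consecutive letters of the pair of words have a crossing. -/
def IsNoncrossing (u w : Fin n → Fin m) : Prop :=
  ∀ i, i + 1 < m → ∀ x, ¬ IsCrossing u w i x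

/-- `x` is the first crossing, `i` the least letter crossing there, and `y` the shortest prefix
of `w` witnessing it. -/
structure IsFirstCrossing (u w : Fin n → Fin m) (i x y : ℕ) : Prop where
  no_crossing_lt : ∀ x' < x, ∀ j, j + 1 < m → ¬ IsCrossing u w j x'
  no_crossing_letter : ∀ j < i, ¬ IsCrossing u w j x
  crossing : IsCrossing u w i x
  letter_le : letterCount u i x ≤ letterCount w i y
  letter_lt : ∀ y' < y, letterCount w i y' < letterCount u i x

lemma exists_isFirstCrossing {u w : Fin n → Fin m} (h : ¬ IsNoncrossing u w) :
    ∃ i x y, i + 1 < m ∧ IsFirstCrossing u w i x y := by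
  have hx : ∃ x, ∃ i, i + 1 < m ∧ IsCrossing u w i x := by
    simp only [IsNoncrossing] at h
    push Not at h
    obtain ⟨i, hi, x, hx⟩ := h
    exact ⟨x, i, hi, hx⟩
  have hi := Nat.find_spec hx
  obtain ⟨him, hcr⟩ := Nat.find_spec hi
  have hy : ∃ y, letterCount u (Nat.find hi) (Nat.find hx) ≤ letterCount w (Nat.find hi) y :=
    hcr.imp fun y hy => hy.1
  refine ⟨Nat.find hi, Nat.find hx, Nat.find hy, him, ?_, ?_, hcr, Nat.find_spec hy, ?_⟩
  · exact fun x' hx' j hj hc => Nat.find_min hx hx' ⟨j, hj, hc⟩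
  · exact fun j hj hc => Nat.find_min hi hj ⟨by omega, hc⟩
  · exact fun y' hy' => not_le.1 (Nat.find_min hy hy')

namespace IsFirstCrossing

variable {u w : Fin n → Fin m} {i x y : ℕ}

lemma unique (h : IsFirstCrossing u w i x y) (him : i + 1 < m) {i' x' y' : ℕ}
    (h' : IsFirstCrossing u w i' x' y') (him' : i' + 1 < m) : i = i' ∧ x = x' ∧ y = y' := by
  obtain rfl : x = x' := le_antisymm
    (not_lt.1 fun hlt => h.no_crossing_lt _ hlt _ him' h'.crossing)
    (not_lt.1 fun hlt => h'.no_crossing_lt _ hlt _ him h.crossing)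
  obtain rfl : i = i' := le_antisymm
    (not_lt.1 fun hlt => h.no_crossing_letter _ hlt h'.crossing)
    (not_lt.1 fun hlt => h'.no_crossing_letter _ hlt h.crossing)
  refine ⟨rfl, rfl, le_antisymm ?_ ?_⟩
  · exact not_lt.1 fun hlt => (h.letter_lt _ hlt).not_ge h'.letter_le
  · exact not_lt.1 fun hlt => (h'.letter_lt _ hlt).not_ge h.letter_le

lemma letter_succ_lt (h : IsFirstCrossing u w i x y) :
    letterCount w (i + 1) y < letterCount u (i + 1) x := by
  obtain ⟨y', hy', hlt⟩ := h.crossing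
  have : y ≤ y' := not_lt.1 fun hlt => (h.letter_lt _ hlt).not_ge hy'
  exact (letterCount_mono w (i + 1) this).trans_lt hlt

lemma le_letter_succ (h : IsFirstCrossing u w i x y) (him : i + 1 < m) {x' : ℕ} (hx' : x' < x) :
    letterCount u (i + 1) x' ≤ letterCount w (i + 1) y := by
  by_contra! hlt
  exact h.no_crossing_lt x' hx' i him ⟨y, (letterCount_mono u i hx'.le).trans h.letter_le, hlt⟩

lemma eq_letter_succ (h : IsFirstCrossing u w i x y) (him : i + 1 < m) :
    letterCount u (i + 1) x = letterCount w (i + 1) y + 1 := by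
  have hlt := h.letter_succ_lt
  obtain _ | x := x
  · simp at hlt
  · have h1 := h.le_letter_succ him x.lt_succ_self
    have h2 := letterCount_succ_le u (i + 1) x
    omega

lemma eq_letter (h : IsFirstCrossing u w i x y) : letterCount u i x = letterCount w i y := by
  refine le_antisymm h.letter_le ?_
  obtain _ | y := y
  · simp
  · have h1 := h.letter_lt y y.lt_succ_self
    have h2 := letterCount_succ_le w i y
    omega

lemma swapTails (h : IsFirstCrossing u w i x y) (him : i + 1 < m) :
    IsFirstCrossing (tailSwap ⟨i, by omega⟩ ⟨i + 1, him⟩ x u)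
      (tailSwap ⟨i, by omega⟩ ⟨i + 1, him⟩ y w) i x y := by
  set a : Fin m := ⟨i, by omega⟩ with ha
  set b : Fin m := ⟨i + 1, him⟩ with hb
  set w' := tailSwap a b y w with hw'
  have hu : ∀ c, ∀ z ≤ x, letterCount (tailSwap a b x u) c z = letterCount u c z :=
    fun c z hz => letterCount_tailSwap_of_le a b x u c hz
  have hw : ∀ c, ∀ z ≤ y, letterCount w' c z = letterCount w c z :=
    fun c z hz => letterCount_tailSwap_of_le a b y w c hz
  have hge : ∀ c, ∀ z, y ≤ z → letterCount w c y ≤ letterCount w' c z := fun c z hz =>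
    (hw c y le_rfl) ▸ letterCount_mono w' c hz
  have hpred : ∀ x' ≤ x, ∀ j, ¬ IsCrossing u w j x' → (x' = x → j < i) → (x' < x → j + 1 < m) →
      ¬ IsCrossing (tailSwap a b x u) w' j x' := by
    rintro x' hx' j hnot hji hjm ⟨z, hz, hlt⟩
    rw [hu _ _ hx'] at hz hlt
    rcases le_total z y with hzy | hzy
    · rw [hw _ _ hzy] at hz hlt
      exact hnot ⟨z, hz, hlt⟩
    by_cases hj : j + 1 = i
    · have h1 := hge i z hzy
      have h2 := letterCount_mono u i hx'
      rw [hj] at hlt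
      have h3 := h.eq_letter
      omega
    have hx'' : j = i ∨ j = i + 1 → x' < x := fun hj' => lt_of_le_of_ne hx' fun he => by
      have := hji he
      omega
    by_cases hj' : j = i
    · subst hj'
      have h1 := hge (j + 1) z hzy
      have h2 := h.le_letter_succ him (hx'' (Or.inl rfl))
      omega
    by_cases hj'' : j = i + 1
    · subst hj''
      have h2 := h.le_letter_succ him (hx'' (Or.inr rfl))
      exact hnot ⟨y, h2, (hge _ z hzy).trans_lt hlt⟩
    · rw [hw', letterCount_tailSwap_of_ne a b y w hj' hj''] at hz
      rw [hw', letterCount_tailSwap_of_ne a b y w (by rwa [ha]) (by simpa [hb] using hj')] at hlt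
      exact hnot ⟨z, hz, hlt⟩
  refine ⟨fun x' hx' j hj => ?_, fun j hj => ?_, ⟨y, ?_, ?_⟩, ?_, fun y' hy' => ?_⟩
  · exact hpred x' hx'.le j (h.no_crossing_lt x' hx' j hj) (fun he => absurd he hx'.ne) fun _ => hj
  · exact hpred x le_rfl j (h.no_crossing_letter j hj) (fun _ => hj) fun he => absurd he (lt_irrefl _)
  · rw [hu _ _ le_rfl, hw _ _ le_rfl]
    exact h.letter_le
  · rw [hu _ _ le_rfl, hw _ _ le_rfl]
    exact h.letter_succ_lt
  · rw [hu _ _ le_rfl, hw _ _ le_rfl]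
    exact h.letter_le
  · rw [hu _ _ le_rfl, hw _ _ hy'.le]
    exact h.letter_lt y' hy'

end IsFirstCrossing

end Crossing

/-- Pairs of words of length `n` in `m` letters together with a permutation `σ` such that the
number of letters `i` in the first word exceeds that in the second one by `i - σ i`. -/
def contentTriples (m n : ℕ) :
    Finset (Equiv.Perm (Fin m) × (Fin n → Fin m) × (Fin n → Fin m)) :=
  Finset.univ.filter fun s => ∀ i : Fin m,
    (letterCount s.2.1 i n : ℤ) - letterCount s.2.2 i n = (i : ℤ) - s.1 i

section SignReversing

variable {m n : ℕ}

lemma mem_contentTriples {σ : Equiv.Perm (Fin m)} {u w : Fin n → Fin m} :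
    (σ, u, w) ∈ contentTriples m n ↔ ∀ i : Fin m,
      (letterCount u i n : ℤ) - letterCount w i n = (i : ℤ) - σ i := by
  simp [contentTriples]

lemma swapTails_mem_contentTriples {σ : Equiv.Perm (Fin m)} {u w : Fin n → Fin m}
    (hs : (σ, u, w) ∈ contentTriples m n) {i x y : ℕ} (him : i + 1 < m)
    (h : IsFirstCrossing u w i x y) :
    (σ * Equiv.swap ⟨i, by omega⟩ ⟨i + 1, him⟩,
      tailSwap ⟨i, by omega⟩ ⟨i + 1, him⟩ x u, tailSwap ⟨i, by omega⟩ ⟨i + 1, him⟩ y w) ∈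
      contentTriples m n := by
  rw [mem_contentTriples] at hs ⊢
  intro c
  set a : Fin m := ⟨i, by omega⟩ with ha
  set b : Fin m := ⟨i + 1, him⟩ with hb
  have hN : ∃ N, n ≤ N ∧ x ≤ N ∧ y ≤ N := ⟨n + x + y, by omega, by omega, by omega⟩
  obtain ⟨N, hn, hx, hy⟩ := hN
  have h1 := letterCount_tailSwap_of_ge a b x u c hx
  have h2 := letterCount_tailSwap_of_ge a b y w c hy
  have h3 := letterCount_of_ge (tailSwap a b x u) c hn
  have h4 := letterCount_of_ge (tailSwap a b y w) c hn
  have h5 := letterCount_of_ge u (Equiv.swap (a : ℕ) b c) hn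
  have h6 := letterCount_of_ge w (Equiv.swap (a : ℕ) b c) hn
  have h7 := h.eq_letter
  have h8 := h.eq_letter_succ him
  rw [Equiv.Perm.mul_apply]
  by_cases hca : c = a
  · subst hca
    rw [Equiv.swap_apply_left] at h1 h2 h5 h6 ⊢
    have h9 := hs b
    simp only [ha, hb] at *
    push_cast at *
    omega
  by_cases hcb : c = b
  · subst hcb
    rw [Equiv.swap_apply_right] at h1 h2 h5 h6 ⊢
    have h9 := hs a
    simp only [ha, hb] at *
    push_cast at *
    omega
  · rw [Equiv.swap_apply_of_ne_of_ne hca hcb, ← hs c,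
      letterCount_tailSwap_of_ne a b x u (Fin.val_ne_of_ne hca) (Fin.val_ne_of_ne hcb),
      letterCount_tailSwap_of_ne a b y w (Fin.val_ne_of_ne hca) (Fin.val_ne_of_ne hcb)]

lemma sum_sign_crossing :
    ∑ s ∈ (contentTriples m n).filter (fun s => ¬ IsNoncrossing s.2.1 s.2.2),
      ((Equiv.Perm.sign s.1 : ℤ) : ℚ) = 0 := by
  have hex : ∀ s ∈ (contentTriples m n).filter (fun s => ¬ IsNoncrossing s.2.1 s.2.2),
      ∃ s' ∈ (contentTriples m n).filter (fun s => ¬ IsNoncrossing s.2.1 s.2.2),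
      ∃ (i x y : ℕ) (him : i + 1 < m), IsFirstCrossing s.2.1 s.2.2 i x y ∧
        s' = (s.1 * Equiv.swap ⟨i, by omega⟩ ⟨i + 1, him⟩,
          tailSwap ⟨i, by omega⟩ ⟨i + 1, him⟩ x s.2.1,
          tailSwap ⟨i, by omega⟩ ⟨i + 1, him⟩ y s.2.2) := by
    rintro ⟨σ, u, w⟩ hs
    rw [Finset.mem_filter] at hs
    obtain ⟨i, x, y, him, h⟩ := exists_isFirstCrossing hs.2
    refine ⟨_, Finset.mem_filter.2 ⟨swapTails_mem_contentTriples hs.1 him h, ?_⟩,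
      i, x, y, him, h, rfl⟩
    exact fun hnc => hnc i him x (h.swapTails him).crossing
  choose! g hg i x y him hfirst heq using hex
  refine Finset.sum_involution (fun s _ => g s) (fun s hs => ?_) (fun s hs _ he => ?_) hg
    (fun s hs => ?_)
  · rw [heq s hs]
    have hne : (⟨i s, (i s).lt_succ_self.trans (him s hs)⟩ : Fin m) ≠ ⟨i s + 1, him s hs⟩ := by
      simp [Fin.ext_iff]
    simp [Equiv.Perm.sign_mul, Equiv.Perm.sign_swap hne]
  · have h1 := congrArg Prod.fst ((heq s hs).symm.trans he)
    have h2 := mul_eq_left.1 h1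
    rw [Equiv.swap_eq_one_iff] at h2
    simp [Fin.ext_iff] at h2
  · have h1 := hfirst _ (hg s hs)
    have h2 := (hfirst s hs).swapTails (him s hs)
    have h3 := heq _ (hg s hs)
    have h4 := heq s hs
    have h5 : IsFirstCrossing (g s).2.1 (g s).2.2 (i s) (x s) (y s) := by rw [h4]; exact h2
    obtain ⟨h6, h7, h8⟩ := h1.unique (him _ (hg s hs)) h5 (him s hs)
    simp only [h6, h7, h8] at h3
    refine h3.trans ?_
    simp [h4, tailSwap_tailSwap, mul_assoc]

lemma IsNoncrossing.perm_eq_one {σ : Equiv.Perm (Fin m)} {u w : Fin n → Fin m}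
    (h : IsNoncrossing u w) (hs : (σ, u, w) ∈ contentTriples m n) : σ = 1 := by
  rw [mem_contentTriples] at hs
  have hmono : StrictMono σ := by
    obtain _ | k := m
    · exact fun a => a.elim0
    rw [Fin.strictMono_iff_lt_succ]
    intro i
    have hi : (i : ℕ) + 1 < k + 1 := by omega
    have h1 := hs i.castSucc
    have h2 := hs i.succ
    have h3 : ¬ IsCrossing u w i (n + letterCount w i n) := h i hi _
    simp only [IsCrossing, not_exists, not_and, not_lt] at h3
    have h4 := h3 (n + letterCount u i n) (by
      rw [letterCount_of_ge u i (Nat.le_add_right _ _),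
        letterCount_of_ge w i (Nat.le_add_right _ _)]
      omega)
    rw [letterCount_of_ge u _ (Nat.le_add_right _ _),
        letterCount_of_ge w _ (Nat.le_add_right _ _)] at h4
    simp only [Fin.val_castSucc, Fin.val_succ] at h1 h2
    rw [Fin.lt_def]
    push_cast at *
    omega
  have := (hmono.range_inj (strictMono_id (α := Fin m))).1
    (by rw [σ.surjective.range_eq, Set.range_id])
  exact Equiv.ext fun i => congrFun this i

/-- The signed number of content triples is the number of noncrossing pairs of words having the
same content. -/
lemma sum_sign_contentTriples :
    ∑ s ∈ contentTriples m n, ((Equiv.Perm.sign s.1 : ℤ) : ℚ) =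
      Nat.card {p : (Fin n → Fin m) × (Fin n → Fin m) //
        (∀ i : Fin m, letterCount p.1 i n = letterCount p.2 i n) ∧ IsNoncrossing p.1 p.2} := by
  rw [← Finset.sum_filter_add_sum_filter_not _ (fun s => IsNoncrossing s.2.1 s.2.2),
    sum_sign_crossing, add_zero, Nat.card_eq_fintype_card, Fintype.card_subtype]
  rw [Finset.sum_congr rfl (g := fun _ => (1 : ℚ)), Finset.sum_const, nsmul_one, Nat.cast_inj]
  · refine Finset.card_bij' (fun s _ => s.2) (fun p _ => (1, p)) ?_ ?_ ?_ ?_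
    · rintro ⟨σ, u, w⟩ hs
      rw [Finset.mem_filter] at hs
      obtain rfl := hs.2.perm_eq_one hs.1
      simp only [Finset.mem_filter, Finset.mem_univ, true_and]
      refine ⟨fun i => ?_, hs.2⟩
      have := mem_contentTriples.1 hs.1 i
      simp only [Equiv.Perm.one_apply, sub_self] at this
      omega
    · rintro ⟨u, w⟩ hp
      simp only [Finset.mem_filter, Finset.mem_univ, true_and] at hp
      rw [Finset.mem_filter, mem_contentTriples]
      exact ⟨fun i => by simp [hp.1 i], hp.2⟩
    · rintro ⟨σ, u, w⟩ hs
      rw [Finset.mem_filter] at hs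
      rw [hs.2.perm_eq_one hs.1]
    · exact fun _ _ => rfl
  · rintro ⟨σ, u, w⟩ hs
    rw [Finset.mem_filter] at hs
    simp [hs.2.perm_eq_one hs.1]

end SignReversing

/-! ### Permutations and noncrossing pairs of words -/

section Ranks

variable {m n : ℕ} (u : Fin n → Fin m) {c : ℕ}

lemma exists_letterCount_eq {r x : ℕ} (hx : x ≤ n) (hr : r < letterCount u c x) :
    ∃ p : Fin n, p.val < x ∧ (u p : ℕ) = c ∧ letterCount u c p = r := by
  induction x with
  | zero => simp at hr
  | succ x ih =>
    rcases lt_or_ge r (letterCount u c x) with h | h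
    · obtain ⟨p, hp, hp'⟩ := ih (by omega) h
      exact ⟨p, by omega, hp'⟩
    · have hs := letterCount_succ_fin u c ⟨x, hx⟩
      simp only at hs
      refine ⟨⟨x, hx⟩, Nat.lt_succ_self x, ?_⟩
      split_ifs at hs with hc
      · exact ⟨hc, by simp only; omega⟩
      · omega

lemma letterCount_lt {p : Fin n} (hp : (u p : ℕ) = c) {x : ℕ} (hx : p.val < x) :
    letterCount u c p < letterCount u c x := by
  have h1 := letterCount_succ_fin u c p
  have h2 := letterCount_mono u c (Nat.succ_le_of_lt hx)
  rw [if_pos hp] at h1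
  simp only [Nat.succ_eq_add_one] at h2
  omega

lemma le_of_letterCount_le {p : Fin n} (hp : (u p : ℕ) = c) {x : ℕ}
    (h : letterCount u c x ≤ letterCount u c p) : x ≤ p :=
  not_lt.1 fun hlt => (letterCount_lt u hp hlt).not_ge h

lemma eq_of_letterCount_eq {p q : Fin n} (hpq : u p = u q)
    (h : letterCount u (u p) p = letterCount u (u p) q) : p = q :=
  Fin.ext (le_antisymm (le_of_letterCount_le u (by rw [hpq]) h.le)
    (le_of_letterCount_le u rfl h.ge))

end Ranks

/-- The permutation `π` carries the `k`-th occurrence of each letter in `u` to the `k`-th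
occurrence of that letter in `w`. -/
def IsStandardization {m n : ℕ} (π : Equiv.Perm (Fin n)) (u w : Fin n → Fin m) : Prop :=
  ∀ p, w (π p) = u p ∧ letterCount w (u p) (π p) = letterCount u (u p) p

/-- Each letter of `u` labels an increasing subsequence of `π`, and each position labelled `c + 1`
is preceded by a position labelled `c` with a larger value. -/
structure IsGreedyLabelling {m n : ℕ} (π : Equiv.Perm (Fin n)) (u : Fin n → Fin m) : Prop where
  lt : ∀ p q, p < q → u p = u q → π p < π q
  exists_pred : ∀ p c, (u p : ℕ) = c + 1 → ∃ q < p, π p < π q ∧ (u q : ℕ) = c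

section Standardization

variable {m n : ℕ} {π : Equiv.Perm (Fin n)} {u w : Fin n → Fin m}

lemma exists_isStandardization (h : ∀ i : Fin m, letterCount u i n = letterCount w i n) :
    ∃ π, IsStandardization π u w := by
  have hex : ∀ p : Fin n, ∃ q : Fin n, w q = u p ∧
      letterCount w (u p) q = letterCount u (u p) p := fun p => by
    obtain ⟨q, -, hq, hr⟩ := exists_letterCount_eq w (c := u p) (r := letterCount u (u p) p)
      le_rfl (by rw [← h]; exact letterCount_lt u rfl p.isLt)
    exact ⟨q, Fin.ext hq, hr⟩
  choose f hf hr using hex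
  have hinj : Function.Injective f := fun p q hpq => by
    have hu : u p = u q := by rw [← hf p, ← hf q, hpq]
    exact eq_of_letterCount_eq u hu (by rw [← hr p, hpq, hu, hr q])
  exact ⟨Equiv.ofBijective f (Finite.injective_iff_bijective.1 hinj), fun p => ⟨hf p, hr p⟩⟩

lemma IsStandardization.unique (h : IsStandardization π u w) {π' : Equiv.Perm (Fin n)}
    (h' : IsStandardization π' u w) : π = π' := by
  refine Equiv.ext fun p => eq_of_letterCount_eq w ?_ ?_
  · rw [(h p).1, (h' p).1]
  · rw [(h p).1, (h p).2, (h' p).2]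

lemma IsStandardization.isGreedyLabelling (h : IsStandardization π u w)
    (hnc : IsNoncrossing u w) : IsGreedyLabelling π u := by
  refine ⟨fun p q hpq hu => ?_, fun p c hp => ?_⟩
  · have h1 := letterCount_lt u rfl (Fin.lt_def.1 hpq)
    have h2 := h q
    rw [← (h p).2, hu, ← h2.2] at h1
    exact Fin.lt_def.2 (not_le.1 fun hle => h1.not_ge (letterCount_mono w _ hle))
  · have hcm : c + 1 < m := hp ▸ (u p).isLt
    have h1 := hnc c hcm (p + 1)
    simp only [IsCrossing, not_exists, not_and', not_le] at h1
    have h2 := h1 (π p) (by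
      have h3 := (h p).2
      rw [hp] at h3
      rw [h3]
      exact letterCount_lt u hp (Nat.lt_succ_self _))
    rw [letterCount_succ_fin, if_neg (by omega), add_zero] at h2
    obtain ⟨q, hqp, hq, hr⟩ := exists_letterCount_eq u p.isLt.le h2
    have h4 := h q
    rw [hq, hr] at h4
    refine ⟨q, hqp, lt_of_le_of_ne ?_ ?_, hq⟩
    · exact Fin.le_def.2 (le_of_letterCount_le w (by rw [h4.1, hq]) h4.2.ge)
    · intro he
      have h5 := congrArg Fin.val (π.injective he)
      omega

lemma IsGreedyLabelling.isStandardization (h : IsGreedyLabelling π u) :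
    IsStandardization π u (u ∘ π.symm) := by
  refine fun p => ⟨by simp, ?_⟩
  rw [letterCount_eq_card _ _ (π p).isLt.le, letterCount_eq_card _ _ p.isLt.le]
  symm
  refine Finset.card_equiv π fun q => ?_
  simp only [Finset.mem_filter, Finset.mem_univ, true_and, Function.comp_apply,
    Equiv.symm_apply_apply, Fin.val_inj, Fin.val_fin_lt]
  refine and_congr_left fun hq => ⟨fun hlt => h.lt q p hlt hq, fun hlt => ?_⟩
  refine lt_of_le_of_ne (not_lt.1 fun hlt' => ?_) (by rintro rfl; exact lt_irrefl _ hlt)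
  exact lt_asymm hlt (h.lt p q hlt' hq.symm)

lemma letterCount_comp_symm (c : ℕ) :
    letterCount (u ∘ π.symm) c n = letterCount u c n := by
  rw [letterCount_length, letterCount_length]
  symm
  exact Finset.card_equiv π fun q => by simp

lemma IsGreedyLabelling.isNoncrossing (h : IsGreedyLabelling π u) :
    IsNoncrossing u (u ∘ π.symm) := by
  have hst := h.isStandardization
  have hcont := letterCount_comp_symm (π := π) (u := u)
  generalize hw : u ∘ π.symm = w at *
  rintro i - x ⟨y, hle, hlt⟩
  rcases le_total n y with hy | hy
  · have h1 := letterCount_of_ge w i hy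
    have h2 := letterCount_of_ge w (i + 1) hy
    rw [hcont] at h1 h2
    rcases le_total x n with hx | hx
    · have h3 := letterCount_mono u (i + 1) hx
      omega
    · have h3 := letterCount_of_ge u i hx
      have h4 := letterCount_of_ge u (i + 1) hx
      omega
  · rcases le_or_gt x n with hx | hx
    · obtain ⟨p, hpx, hp, hr⟩ := exists_letterCount_eq u hx hlt
      obtain ⟨q, hqp, hπ, hq⟩ := h.exists_pred p i hp
      have h1 := hst p
      rw [hp, hr] at h1
      have h2 : y ≤ π p := le_of_letterCount_le w (by rw [h1.1, hp]) h1.2.ge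
      have h3 := hst q
      rw [hq] at h3
      have h4 := letterCount_mono w i (h2.trans (Fin.lt_def.1 hπ).le)
      have h5 := letterCount_lt u hq ((Fin.lt_def.1 hqp).trans hpx)
      omega
    · have h1 := letterCount_of_ge u i hx.le
      have h2 := letterCount_mono w i hy
      rw [hcont] at h2
      omega

lemma IsGreedyLabelling.lt_of_inversion (h : IsGreedyLabelling π u) {p q : Fin n} (hpq : p < q)
    (hπ : π q < π p) : u p < u q := by
  have key : ∀ c : ℕ, ∀ p : Fin n, p < q → π q < π p → (u p : ℕ) = u q + c → False := by
    intro c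
    induction c with
    | zero => exact fun p hpq hπ hu => lt_asymm hπ (h.lt p q hpq (Fin.ext hu))
    | succ c ih =>
      intro p hpq hπ hu
      obtain ⟨p', hp', hπ', hu'⟩ := h.exists_pred p _ hu
      exact ih p' (hp'.trans hpq) (hπ.trans hπ') hu'
  by_contra! hle
  exact key (u p - u q) p hpq hπ (by rw [Fin.le_def] at hle; omega)

lemma IsGreedyLabelling.le {u' : Fin n → Fin m} (h : IsGreedyLabelling π u)
    (h' : IsGreedyLabelling π u') (p : Fin n) : u p ≤ u' p := by
  induction p using WellFoundedLT.induction with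
  | ind p ih =>
    rw [Fin.le_def]
    rcases hc : (u p : ℕ) with _ | c
    · exact Nat.zero_le _
    · obtain ⟨q, hqp, hπ, hq⟩ := h.exists_pred p c hc
      have h1 := Fin.le_def.1 (ih q hqp)
      have h2 := Fin.lt_def.1 (h'.lt_of_inversion hqp hπ)
      omega

lemma IsGreedyLabelling.unique {u' : Fin n → Fin m} (h : IsGreedyLabelling π u)
    (h' : IsGreedyLabelling π u') : u = u' :=
  funext fun p => le_antisymm (h.le h' p) (h'.le h p)

lemma IsGreedyLabelling.not_hasAscSeq (h : IsGreedyLabelling π u) :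
    ¬ HasAscSeq (π.trans Fin.revPerm) (m + 1) := by
  rintro ⟨s, hs, hπ⟩
  have hmono : StrictMono (u ∘ s) := fun a b hab =>
    h.lt_of_inversion (hs hab) (by simpa using hπ hab)
  simpa using Fintype.card_le_of_injective _ hmono.injective

end Standardization

/-- One less than the greatest length of a decreasing subsequence of `π` ending at position `p`. -/
def decHeight {n : ℕ} (π : Equiv.Perm (Fin n)) (p : Fin n) : ℕ :=
  Finset.univ.sup fun q : {q : Fin n // q < p ∧ π p < π q} => decHeight π q.1 + 1
termination_by p
decreasing_by exact q.2.1

section DecHeight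

variable {m n : ℕ} {π : Equiv.Perm (Fin n)}

lemma decHeight_lt {p q : Fin n} (hqp : q < p) (hπ : π p < π q) :
    decHeight π q < decHeight π p := by
  rw [decHeight.eq_1 π p]
  exact Finset.le_sup (f := fun q : {q : Fin n // q < p ∧ π p < π q} => decHeight π q.1 + 1)
    (Finset.mem_univ ⟨q, hqp, hπ⟩)

lemma exists_decHeight_eq {p : Fin n} {c : ℕ} (hp : decHeight π p = c + 1) :
    ∃ q < p, π p < π q ∧ decHeight π q = c := by
  rw [decHeight] at hp
  have hne : (Finset.univ : Finset {q : Fin n // q < p ∧ π p < π q}).Nonempty := by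
    by_contra hne
    rw [Finset.not_nonempty_iff_eq_empty.1 hne] at hp
    simp at hp
  obtain ⟨⟨q, hqp, hπ⟩, -, hq⟩ := Finset.exists_mem_eq_sup _ hne
    fun q : {q : Fin n // q < p ∧ π p < π q} => decHeight π q.1 + 1
  exact ⟨q, hqp, hπ, by simp only at hq; omega⟩

lemma exists_decreasing (c : ℕ) (p : Fin n) (hp : decHeight π p = c) :
    ∃ s : Fin (c + 1) → Fin n, StrictMono s ∧ StrictAnti (fun a => π (s a)) ∧
      s (Fin.last c) = p := by
  induction c generalizing p with
  | zero => exact ⟨fun _ => p, fun a b hab => by omega, fun a b hab => by omega, rfl⟩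
  | succ c ih =>
    obtain ⟨q, hqp, hπ, hq⟩ := exists_decHeight_eq hp
    obtain ⟨s, hs, hs', hlast⟩ := ih q hq
    refine ⟨Fin.snoc s p, ?_, ?_, Fin.snoc_last _ _⟩
    · rw [Fin.strictMono_iff_lt_succ]
      intro i
      induction i using Fin.lastCases with
      | last => rw [Fin.snoc_castSucc, Fin.succ_last, Fin.snoc_last, hlast]; exact hqp
      | cast i =>
        rw [Fin.snoc_castSucc, Fin.succ_castSucc, Fin.snoc_castSucc]
        exact hs i.castSucc_lt_succ
    · rw [Fin.strictAnti_iff_succ_lt]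
      intro i
      induction i using Fin.lastCases with
      | last => rw [Fin.snoc_castSucc, Fin.succ_last, Fin.snoc_last, hlast]; exact hπ
      | cast i =>
        rw [Fin.snoc_castSucc, Fin.succ_castSucc, Fin.snoc_castSucc]
        exact hs' i.castSucc_lt_succ

lemma exists_isGreedyLabelling (h : ¬ HasAscSeq (π.trans Fin.revPerm) (m + 1)) :
    ∃ u : Fin n → Fin m, IsGreedyLabelling π u := by
  have hlt : ∀ p, decHeight π p < m := by
    by_contra! hge
    obtain ⟨p, hp⟩ := hge
    obtain ⟨s, hs, hs', -⟩ := exists_decreasing _ p rfl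
    have hle : m + 1 ≤ decHeight π p + 1 := by omega
    refine h ⟨s ∘ Fin.castLE hle, hs.comp (Fin.strictMono_castLE hle), fun a b hab => ?_⟩
    simpa using hs' (Fin.strictMono_castLE hle hab)
  refine ⟨fun p => ⟨decHeight π p, hlt p⟩, fun p q hpq hu => ?_, fun p c hp =>
    exists_decHeight_eq hp⟩
  rw [Fin.mk.injEq] at hu
  refine lt_of_le_of_ne (not_lt.1 fun hgt => (decHeight_lt hpq hgt).ne hu) fun he => ?_
  exact hpq.ne (π.injective he)

end DecHeight

/-- Permutations without ascending subsequences of length `m + 1` are equinumerous with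
noncrossing pairs of words in `m` letters with the same content. -/
lemma permCount_eq_card_noncrossing (m n : ℕ) : permCount m n =
    Nat.card {p : (Fin n → Fin m) × (Fin n → Fin m) //
      (∀ i : Fin m, letterCount p.1 i n = letterCount p.2 i n) ∧ IsNoncrossing p.1 p.2} := by
  trans Nat.card {s : Equiv.Perm (Fin n) × (Fin n → Fin m) // IsGreedyLabelling s.1 s.2}
  · refine (Nat.card_eq_of_bijective
      (fun s => ⟨s.1.1.trans Fin.revPerm, s.2.not_hasAscSeq⟩) ⟨?_, ?_⟩).symm
    · rintro ⟨⟨π, u⟩, h⟩ ⟨⟨π', u'⟩, h'⟩ he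
      rw [Subtype.mk.injEq] at he
      obtain rfl : π = π' := Equiv.ext fun p => by simpa using Equiv.congr_fun he p
      obtain rfl : u = u' := h.unique h'
      rfl
    · rintro ⟨τ, hτ⟩
      have hrev : (τ.trans Fin.revPerm).trans Fin.revPerm = τ := Equiv.ext fun p => by simp
      rw [← hrev] at hτ
      obtain ⟨u, hu⟩ := exists_isGreedyLabelling hτ
      exact ⟨⟨⟨_, u⟩, hu⟩, Subtype.ext hrev⟩
  · refine Nat.card_eq_of_bijective
      (fun s => ⟨(s.1.2, s.1.2 ∘ s.1.1.symm), fun i => (letterCount_comp_symm _).symm,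
        s.2.isNoncrossing⟩) ⟨?_, ?_⟩
    · rintro ⟨⟨π, u⟩, h⟩ ⟨⟨π', u'⟩, h'⟩ he
      rw [Subtype.mk.injEq, Prod.mk.injEq] at he
      obtain ⟨rfl, he⟩ := he
      have h1 := h'.isStandardization
      rw [← he] at h1
      obtain rfl := h.isStandardization.unique h1
      rfl
    · rintro ⟨⟨u, w⟩, hcont, hnc⟩
      obtain ⟨π, hπ⟩ := exists_isStandardization hcont
      refine ⟨⟨⟨π, u⟩, hπ.isGreedyLabelling hnc⟩, Subtype.ext (Prod.ext rfl ?_)⟩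
      funext q
      exact (hπ (π.symm q)).1.symm.trans (by rw [Equiv.apply_symm_apply])

/-! ### Exponential generating functions of words -/

section Counting

variable {m n : ℕ}

/-- The words with content `a` are counted by a multinomial coefficient. -/
lemma card_content_eq (a : Fin m → ℕ) (ha : ∑ i, a i = n) :
    ((Finset.univ.filter fun u : Fin n → Fin m => ∀ i : Fin m, letterCount u i n = a i).card : ℚ)
      = (n.factorial : ℚ) / ∏ i, ((a i).factorial : ℚ) := by
  have hmul : (Finset.univ.filter fun u : Fin n → Fin m =>
      ∀ i : Fin m, letterCount u i n = a i).card = Nat.multinomial Finset.univ a := by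
    have h1 := Fintype.sum_pow (fun i : Fin m => (MvPolynomial.X i : MvPolynomial (Fin m) ℕ)) n
    rw [Finset.sum_pow_eq_sum_piAntidiag] at h1
    have h2 := congrArg (MvPolynomial.coeff (Finsupp.equivFunOnFinite.symm a)) h1
    have h3 : ∀ u : Fin n → Fin m, (∏ p, (MvPolynomial.X (u p) : MvPolynomial (Fin m) ℕ)) =
        ∏ i : Fin m, MvPolynomial.X i ^ letterCount u i n := fun u => by
      rw [← Finset.prod_fiberwise (s := Finset.univ) (g := u)]
      refine Finset.prod_congr rfl fun i _ => ?_
      rw [Finset.prod_congr rfl (g := fun _ => MvPolynomial.X i) (by simp), Finset.prod_const,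
        letterCount_length]
      congr 2
      ext p
      simp [Fin.ext_iff]
    have h4 : ∀ x : Fin m → ℕ, (Finsupp.equivFunOnFinite.symm a =
        Finsupp.indicator Finset.univ fun i _ => x i) ↔ x = a := fun x => by
      simp [Finsupp.ext_iff, funext_iff, eq_comm]
    simp only [h3, MvPolynomial.coeff_sum, MvPolynomial.coeff_prod_X_pow, h4,
      ← MvPolynomial.C_eq_coe_nat, MvPolynomial.coeff_C_mul] at h2
    rw [Finset.card_filter]
    simp only [funext_iff] at h2
    rw [← h2, Finset.sum_eq_single a]
    · simp
    · intro x _ hx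
      rw [if_neg (fun h => hx (funext h)), mul_zero]
    · intro h
      exact absurd (Finset.mem_piAntidiag.2 ⟨ha, fun i _ => Finset.mem_univ i⟩) h
  have hpos : (∏ i, ((a i).factorial : ℚ)) ≠ 0 :=
    Finset.prod_ne_zero_iff.2 fun i _ => Nat.cast_ne_zero.2 (Nat.factorial_ne_zero _)
  rw [hmul, eq_div_iff hpos, mul_comm, ← ha, ← Nat.multinomial_spec Finset.univ a]
  push_cast
  rfl

lemma sum_letterCount (u : Fin n → Fin m) : ∑ i : Fin m, letterCount u i n = n := by
  simp only [letterCount_length, Fin.val_inj]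
  rw [← Finset.card_eq_sum_card_fiberwise (fun p _ => Finset.mem_coe.2 (Finset.mem_univ (u p)))]
  simp

/-- Pairs of words with prescribed sums and differences of contents are counted by a product of
coefficients of Bessel series. -/
lemma prod_coeff_besselI (k : Fin m → ℤ) (hk : ∑ i, k i = 0) (c : Fin m → ℕ)
    (hc : ∑ i, c i = 2 * n) :
    ∏ i, PowerSeries.coeff (c i) (besselI (k i)) =
      ((Finset.univ.filter fun p : (Fin n → Fin m) × (Fin n → Fin m) =>
        (∀ i : Fin m, (letterCount p.1 i n : ℤ) - letterCount p.2 i n = k i) ∧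
        ∀ i : Fin m, letterCount p.1 i n + letterCount p.2 i n = c i).card : ℚ) /
      (n.factorial : ℚ) ^ 2 := by
  simp only [besselI, PowerSeries.coeff_mk]
  by_cases hcond : ∀ i, 0 ≤ (c i : ℤ) - k i ∧ 0 ≤ (c i : ℤ) + k i ∧ 2 ∣ (c i : ℤ) - k i
  · have hab : ∀ i, ∃ a b : ℕ, (a : ℤ) - b = k i ∧ a + b = c i := fun i => by
      obtain ⟨h1, h2, h3⟩ := hcond i
      exact ⟨(((c i : ℤ) + k i) / 2).toNat, (((c i : ℤ) - k i) / 2).toNat, by omega, by omega⟩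
    choose a b hdiff hsum using hab
    have h1 : (∑ i, (a i : ℤ)) - ∑ i, (b i : ℤ) = 0 := by
      rw [← hk, ← Finset.sum_sub_distrib]
      exact Finset.sum_congr rfl fun i _ => hdiff i
    have h2 : ∑ i, a i + ∑ i, b i = 2 * n := by
      rw [← hc, ← Finset.sum_add_distrib]
      exact Finset.sum_congr rfl fun i _ => hsum i
    rw [← Nat.cast_sum, ← Nat.cast_sum] at h1
    have ha : ∑ i, a i = n := by omega
    have hb : ∑ i, b i = n := by omega
    have hfil : (Finset.univ.filter fun p : (Fin n → Fin m) × (Fin n → Fin m) =>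
        (∀ i : Fin m, (letterCount p.1 i n : ℤ) - letterCount p.2 i n = k i) ∧
        ∀ i : Fin m, letterCount p.1 i n + letterCount p.2 i n = c i) =
        (Finset.univ.filter fun u : Fin n → Fin m => ∀ i : Fin m, letterCount u i n = a i) ×ˢ
        (Finset.univ.filter fun u : Fin n → Fin m => ∀ i : Fin m, letterCount u i n = b i) := by
      ext ⟨u, w⟩
      simp only [Finset.mem_filter, Finset.mem_univ, true_and, Finset.mem_product,
        ← forall_and]
      refine forall_congr' fun i => ?_
      have h3 := hdiff i
      have h4 := hsum i
      omega
    rw [hfil, Finset.card_product, Nat.cast_mul, card_content_eq a ha, card_content_eq b hb]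
    have hval : ∀ i, (if 0 ≤ (c i : ℤ) - k i ∧ 0 ≤ (c i : ℤ) + k i ∧ 2 ∣ (c i : ℤ) - k i then
        (1 : ℚ) / ((Nat.factorial (((c i : ℤ) - k i) / 2).toNat : ℚ) *
           (Nat.factorial (((c i : ℤ) + k i) / 2).toNat : ℚ)) else 0) =
        1 / (((a i).factorial : ℚ) * (b i).factorial) := fun i => by
      have h3 := hdiff i
      have h4 := hsum i
      rw [if_pos (hcond i), show (((c i : ℤ) - k i) / 2).toNat = b i by omega,
        show (((c i : ℤ) + k i) / 2).toNat = a i by omega, mul_comm ((b i).factorial : ℚ)]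
    rw [Finset.prod_congr rfl fun i _ => hval i, Finset.prod_div_distrib,
      Finset.prod_mul_distrib, Finset.prod_const_one]
    have hn : (n.factorial : ℚ) ≠ 0 := Nat.cast_ne_zero.2 (Nat.factorial_ne_zero _)
    field_simp
  · rw [Finset.filter_eq_empty_iff.2, Finset.card_empty, Nat.cast_zero, zero_div]
    · push Not at hcond
      obtain ⟨i, hi⟩ := hcond
      exact Finset.prod_eq_zero (Finset.mem_univ i) (if_neg fun h => hi h.1 h.2.1 h.2.2)
    · rintro ⟨u, w⟩ - ⟨hd, hs⟩
      refine hcond fun i => ?_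
      have h3 := hd i
      have h4 := hs i
      simp only at h3 h4
      omega

lemma coeff_prod_besselI_even (k : Fin m → ℤ) (hk : ∑ i, k i = 0) :
    PowerSeries.coeff (2 * n) (∏ i, besselI (k i)) =
      ((Finset.univ.filter fun p : (Fin n → Fin m) × (Fin n → Fin m) =>
        ∀ i : Fin m, (letterCount p.1 i n : ℤ) - letterCount p.2 i n = k i).card : ℚ) /
      (n.factorial : ℚ) ^ 2 := by
  rw [PowerSeries.coeff_prod, Finset.card_eq_sum_card_fiberwise
    (f := fun p => Finsupp.equivFunOnFinite.symm fun i : Fin m =>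
      letterCount p.1 i n + letterCount p.2 i n)
    (t := Finset.finsuppAntidiag Finset.univ (2 * n)), Nat.cast_sum, Finset.sum_div]
  · refine Finset.sum_congr rfl fun c hc => ?_
    rw [prod_coeff_besselI (n := n) k hk c (Finset.mem_finsuppAntidiag.1 hc).1,
      Finset.filter_filter]
    simp [Finsupp.ext_iff]
  · rintro ⟨u, w⟩ -
    rw [Finset.mem_coe, Finset.mem_finsuppAntidiag]
    refine ⟨?_, Finset.subset_univ _⟩
    simp [Finset.sum_add_distrib, sum_letterCount, two_mul]

lemma coeff_prod_besselI_odd (k : Fin m → ℤ) (hk : ∑ i, k i = 0) {N : ℕ} (hN : N % 2 ≠ 0) :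
    PowerSeries.coeff N (∏ i, besselI (k i)) = 0 := by
  rw [PowerSeries.coeff_prod]
  refine Finset.sum_eq_zero fun c hc => ?_
  rw [Finset.prod_eq_zero_iff]
  by_contra! hne
  have hdvd : ∀ i, (2 : ℤ) ∣ c i - k i := fun i => by
    have h := hne i (Finset.mem_univ i)
    rw [besselI, PowerSeries.coeff_mk] at h
    by_contra hnd
    exact h (if_neg fun h' => hnd h'.2.2)
  have h := Finset.dvd_sum fun i (_ : i ∈ Finset.univ) => hdvd i
  rw [Finset.sum_sub_distrib, hk, sub_zero, ← Nat.cast_sum, (Finset.mem_finsuppAntidiag.1 hc).1]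
    at h
  omega

end Counting

lemma sum_sub_perm_eq_zero {m : ℕ} (σ : Equiv.Perm (Fin m)) :
    ∑ i : Fin m, ((i : ℤ) - σ i) = 0 := by
  rw [Finset.sum_sub_distrib, Equiv.sum_comp σ fun i : Fin m => (i : ℤ), sub_self]

lemma coeff_det_besselI_even (m n : ℕ) : PowerSeries.coeff (2 * n)
    (Matrix.det (Matrix.of fun i j : Fin m => besselI ((i : ℤ) - (j : ℤ)))) =
      (permCount m n : ℚ) / (n.factorial : ℚ) ^ 2 := by
  rw [permCount_eq_card_noncrossing, ← sum_sign_contentTriples, contentTriples, Finset.sum_filter,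
    Fintype.sum_prod_type, Finset.sum_div, ← Matrix.det_transpose, Matrix.det_apply, map_sum]
  refine Finset.sum_congr rfl fun σ _ => ?_
  simp only [Matrix.transpose_apply, Matrix.of_apply]
  rw [← Finset.sum_filter, Finset.sum_const, nsmul_eq_mul, Units.smul_def, map_zsmul,
    coeff_prod_besselI_even _ (sum_sub_perm_eq_zero σ), zsmul_eq_mul]
  ring

/-- Gessel's formula: `∑_{n≥0} s_n^{(m)} t^{2n}/(n!)² = det(I_{i−j})_{1≤i,j≤m}`. -/
theorem gessel_det_formula (m : ℕ) (hm : 1 ≤ m) :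
    (PowerSeries.mk fun N : ℕ =>
        if N % 2 = 0 then
          (permCount m (N / 2) : ℚ) / ((Nat.factorial (N / 2) : ℚ)) ^ 2
        else 0)
      = Matrix.det (Matrix.of fun i j : Fin m => besselI ((i : ℤ) - (j : ℤ))) := by
  ext N
  rw [PowerSeries.coeff_mk]
  split_ifs with hN
  · rw [← coeff_det_besselI_even, Nat.mul_div_cancel' (Nat.dvd_of_mod_eq_zero hN)]
  · rw [← Matrix.det_transpose, Matrix.det_apply, map_sum]
    refine (Finset.sum_eq_zero fun σ _ => ?_).symm
    simp only [Matrix.transpose_apply, Matrix.of_apply]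
    rw [Units.smul_def, map_zsmul, coeff_prod_besselI_odd _ (sum_sub_perm_eq_zero σ) hN,
      smul_zero]
end
end

section
/- For every integer ℓ ≥ 1 and m = 2ℓ+1, the following identity of formal power series in ℚ[[t]] holds: ∑_{n≥0} i_n^{(m)} · t^n/n! = e^t · det( I_{i−j} − I_{i+j} )_{1≤i,j≤ℓ}, where i_n^{(m)} denotes the number of involutions in I_n^{(m)} and e^t = ∑_{n≥0} t^n/n!. -/
open scoped Classical

noncomputable section

/-- `f` has a descending subsequence of length `k`. -/
def HasDescSeq {n : ℕ} (f : Fin n → Fin n) (k : ℕ) : Prop :=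
  ∃ s : Fin k → Fin n, StrictMono s ∧ StrictAnti fun a => f (s a)

/-- The number of involutions of `{1,…,n}` with no descending subsequence of
length `m+1`, i.e. the cardinality of `I_n^{(m)}`. -/
def invCount (m n : ℕ) : ℕ :=
  Nat.card {τ : Equiv.Perm (Fin n) //
    Function.Involutive ⇑τ ∧ ¬ HasDescSeq (⇑τ) (m + 1)}

/-- `NestAt τ i k`: at least `k` mutually nested arcs `j < τ j` of `τ` cover the point `i`. -/
def NestAt {n : ℕ} (τ : Equiv.Perm (Fin n)) (i : Fin n) (k : ℕ) : Prop :=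
  ∃ A : Finset (Fin n), k ≤ A.card ∧ (∀ j ∈ A, j ≤ i ∧ i ≤ τ j ∧ j < τ j) ∧
    ∀ a ∈ A, ∀ b ∈ A, a < b → τ b < τ a

/-- The set of involutions whose arc type is `w` and whose nestings are bounded by `c`. -/
def typedInvs (n : ℕ) (w : ℕ → SignType) (c : ℕ → ℕ) : Finset (Equiv.Perm (Fin n)) :=
  Finset.univ.filter fun τ => Function.Involutive τ ∧
    (∀ i : Fin n, SignType.sign ((τ i : ℤ) - (i : ℤ)) = w i) ∧ ∀ i : Fin n, ¬ NestAt τ i (c i)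

lemma NestAt.mono {n : ℕ} {τ : Equiv.Perm (Fin n)} {i : Fin n} {k l : ℕ} (h : NestAt τ i k)
    (hl : l ≤ k) : NestAt τ i l := by
  obtain ⟨A, h1, h2⟩ := h
  exact ⟨A, hl.trans h1, h2⟩

lemma swap_lt_swap {n : ℕ} {p q x y : Fin n} (hpq : p < q) (hxy : x < y)
    (hx : ¬ (p < x ∧ x < q)) (hy : ¬ (p < y ∧ y < q)) (h : ¬ (x = p ∧ y = q)) :
    Equiv.swap p q x < Equiv.swap p q y := by
  simp only [Equiv.swap_apply_def]
  split_ifs <;> grind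

/-- Conjugating by a transposition that is monotone on the arcs of a nesting keeps it nested. -/
lemma nestAt_conj {n : ℕ} {τ : Equiv.Perm (Fin n)} {p q i : Fin n} {k : ℕ} (hpq : p < q)
    {A : Finset (Fin n)} (hk : k ≤ A.card) (hA : ∀ a ∈ A, ∀ b ∈ A, a < b → τ b < τ a)
    (h1 : ∀ j ∈ A, ¬ (p < j ∧ j < q)) (h2 : ∀ j ∈ A, ¬ (p < τ j ∧ τ j < q))
    (h3 : p ∉ A ∨ q ∉ A) (h4 : (∀ j ∈ A, τ j ≠ p) ∨ ∀ j ∈ A, τ j ≠ q)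
    (h5 : ∀ j ∈ A, j < τ j ∧ ¬ (j = p ∧ τ j = q))
    (h6 : ∀ j ∈ A, Equiv.swap p q j ≤ i ∧ i ≤ Equiv.swap p q (τ j)) :
    NestAt (Equiv.swap p q * τ * Equiv.swap p q) i k := by
  refine ⟨A.image (Equiv.swap p q), ?_, ?_, ?_⟩
  · rwa [Finset.card_image_of_injective _ (Equiv.injective _)]
  · simp only [Finset.mem_image, forall_exists_index, and_imp, forall_apply_eq_imp_iff₂,
      Equiv.Perm.mul_apply, Equiv.swap_apply_self]
    exact fun j hj => ⟨(h6 j hj).1, (h6 j hj).2,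
      swap_lt_swap hpq (h5 j hj).1 (h1 j hj) (h2 j hj) (h5 j hj).2⟩
  · simp only [Finset.mem_image, forall_exists_index, and_imp, forall_apply_eq_imp_iff₂,
      Equiv.Perm.mul_apply, Equiv.swap_apply_self]
    intro a ha b hb hab
    have hab' : a < b := by
      rcases lt_trichotomy a b with h | h | h
      · exact h
      · simp [h] at hab
      · have := swap_lt_swap hpq h (h1 b hb) (h1 a ha) (by grind)
        exact absurd hab this.not_gt
    exact swap_lt_swap hpq (hA a ha b hb hab') (h2 b hb) (h2 a ha) (by grind)

lemma nestAt_uncross {n : ℕ} {τ : Equiv.Perm (Fin n)} (hτ : Function.Involutive τ) {p q : Fin n}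
    (hpq : p < q) (hp : q < τ p) (hq : τ q < p) (hF : ∀ j, p < j → j < q → τ j = j)
    {i : Fin n} {k : ℕ} (h : NestAt τ i k) :
    NestAt (Equiv.swap p q * τ * Equiv.swap p q) i k ∨ (p ≤ i ∧ i ≤ q) ∧
      (NestAt (Equiv.swap p q * τ * Equiv.swap p q) p k ∨
        NestAt (Equiv.swap p q * τ * Equiv.swap p q) q k) := by
  obtain ⟨A, hk, hal, hA⟩ := h
  have h1 : ∀ j ∈ A, ¬ (p < j ∧ j < q) := by grind
  have h2 : ∀ j ∈ A, ¬ (p < τ j ∧ τ j < q) := fun j hj hh => by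
    have := hF _ hh.1 hh.2
    rw [hτ j] at this; grind
  have h3 : q ∉ A := by grind
  have h4 : ∀ j ∈ A, τ j ≠ p := fun j hj hh => by
    have := hτ j
    rw [hh] at this; grind
  have h5 : ∀ j ∈ A, j < τ j ∧ ¬ (j = p ∧ τ j = q) := by grind
  by_cases hi : p ≤ i ∧ i ≤ q
  · right
    refine ⟨hi, ?_⟩
    by_cases hpA : p ∈ A
    · right
      refine nestAt_conj hpq hk hA h1 h2 (.inr h3) (.inl h4) h5 fun j hj => ?_
      have h7 : τ j ≠ q := fun hh => by
        have := hτ j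
        rw [hh] at this
        have := hA j hj p hpA (by grind)
        grind
      simp only [Equiv.swap_apply_def]
      split_ifs <;> grind
    · left
      refine nestAt_conj hpq hk hA h1 h2 (.inr h3) (.inl h4) h5 fun j hj => ?_
      simp only [Equiv.swap_apply_def]
      split_ifs <;> grind
  · left
    refine nestAt_conj hpq hk hA h1 h2 (.inr h3) (.inl h4) h5 fun j hj => ?_
    simp only [Equiv.swap_apply_def]
    split_ifs <;> grind

lemma nestAt_cross {n : ℕ} {τ : Equiv.Perm (Fin n)} (hτ : Function.Involutive τ) {p q : Fin n}
    (hpq : p < q) (hp : τ p < p) (hq : q < τ q) (hF : ∀ j, p < j → j < q → τ j = j)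
    {i : Fin n} {k : ℕ} (h : NestAt τ i k) :
    NestAt (Equiv.swap p q * τ * Equiv.swap p q) i k := by
  obtain ⟨A, hk, hal, hA⟩ := h
  have h1 : ∀ j ∈ A, ¬ (p < j ∧ j < q) := by grind
  have h2 : ∀ j ∈ A, ¬ (p < τ j ∧ τ j < q) := fun j hj hh => by
    have := hF _ hh.1 hh.2
    rw [hτ j] at this; grind
  have h3 : p ∉ A := by grind
  have h4 : ∀ j ∈ A, τ j ≠ q := fun j hj hh => by
    have := hτ j
    rw [hh] at this; grind
  refine nestAt_conj hpq hk hA h1 h2 (.inl h3) (.inr h4) (by grind) fun j hj => ?_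
  simp only [Equiv.swap_apply_def]
  split_ifs <;> grind

/-- The nesting number is constant between an opener and the next closer. -/
lemma NestAt.move {n : ℕ} {τ : Equiv.Perm (Fin n)} (hτ : Function.Involutive τ) {p q : Fin n}
    (hp : p < τ p) (hq : τ q < q) (hF : ∀ j, p < j → j < q → τ j = j)
    {i i' : Fin n} {k : ℕ} (hi : p ≤ i ∧ i ≤ q) (hi' : p ≤ i' ∧ i' ≤ q) (h : NestAt τ i k) :
    NestAt τ i' k := by
  obtain ⟨A, hk, hal, hA⟩ := h
  refine ⟨A, hk, fun j hj => ?_, hA⟩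
  have h1 : ¬ (p < j ∧ j < q) := by grind
  have h2 : ¬ (p < τ j ∧ τ j < q) := fun hh => by
    have := hF _ hh.1 hh.2
    rw [hτ j] at this; grind
  have h4 : τ j ≠ p := fun hh => by
    have := hτ j
    rw [hh] at this; grind
  grind

lemma nestAt_mul_swap_iff {n : ℕ} {τ : Equiv.Perm (Fin n)} {p q : Fin n} (hpq : p < q)
    (hp : τ p = p) (hq : τ q = q) {i : Fin n} {k : ℕ} (hi : ¬ (p ≤ i ∧ i ≤ q)) :
    NestAt (τ * Equiv.swap p q) i k ↔ NestAt τ i k := by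
  have key : ∀ j, j ≠ p → j ≠ q → (τ * Equiv.swap p q) j = τ j := fun j h1 h2 => by
    simp [Equiv.swap_apply_of_ne_of_ne h1 h2]
  have kp : (τ * Equiv.swap p q) p = q := by simp [hq]
  have kq : (τ * Equiv.swap p q) q = p := by simp [hp]
  constructor
  · rintro ⟨A, hk, hal, hA⟩
    exact ⟨A, hk, by grind, by grind⟩
  · rintro ⟨A, hk, hal, hA⟩
    exact ⟨A, hk, by grind, by grind⟩

lemma nestAt_mul_swap_iff_of_mem {n : ℕ} {τ : Equiv.Perm (Fin n)} (hτ : Function.Involutive τ)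
    {p q : Fin n} (hpq : p < q) (hF : ∀ j, p ≤ j → j ≤ q → τ j = j) {i : Fin n} {k : ℕ}
    (hi : p ≤ i ∧ i ≤ q) :
    NestAt (τ * Equiv.swap p q) i k ↔ NestAt τ i (k - 1) := by
  have key : ∀ j, j ≠ p → j ≠ q → (τ * Equiv.swap p q) j = τ j := fun j h1 h2 => by
    simp [Equiv.swap_apply_of_ne_of_ne h1 h2]
  have kp : (τ * Equiv.swap p q) p = q := by simp [hF q hpq.le le_rfl]
  have kq : (τ * Equiv.swap p q) q = p := by simp [hF p le_rfl hpq.le]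
  constructor
  · rintro ⟨A, hk, hal, hA⟩
    refine ⟨A.erase p, (Nat.sub_le_sub_right hk 1).trans Finset.pred_card_le_card_erase, ?_, ?_⟩
    · grind
    · grind
  · rintro ⟨A, hk, hal, hA⟩
    have hout : ∀ j ∈ A, j < p ∧ q < τ j := fun j hj => by
      have h2 : ¬ (p ≤ τ j ∧ τ j ≤ q) := fun hh => by
        have := hF _ hh.1 hh.2
        rw [hτ j] at this; grind
      grind
    refine ⟨insert p A, ?_, ?_, ?_⟩
    · rw [Finset.card_insert_of_notMem (by grind)]; omega
    · grind
    · grind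

lemma mem_typedInvs {n : ℕ} {w : ℕ → SignType} {c : ℕ → ℕ} {τ : Equiv.Perm (Fin n)} :
    τ ∈ typedInvs n w c ↔ Function.Involutive τ ∧
      (∀ i : Fin n, SignType.sign ((τ i : ℤ) - (i : ℤ)) = w i) ∧
      ∀ i : Fin n, ¬ NestAt τ i (c i) := by
  simp [typedInvs]

lemma sign_sub_eq_one_iff {n : ℕ} (i j : Fin n) :
    SignType.sign ((i : ℤ) - (j : ℤ)) = 1 ↔ j < i := by
  rw [sign_eq_one_iff]; omega

lemma sign_sub_eq_neg_one_iff {n : ℕ} (i j : Fin n) :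
    SignType.sign ((i : ℤ) - (j : ℤ)) = -1 ↔ i < j := by
  rw [sign_eq_neg_one_iff]; omega

lemma sign_sub_eq_zero_iff {n : ℕ} (i j : Fin n) :
    SignType.sign ((i : ℤ) - (j : ℤ)) = 0 ↔ i = j := by
  rw [sign_eq_zero_iff]; omega

lemma sign_conj {n : ℕ} {τ : Equiv.Perm (Fin n)} (hτ : Function.Involutive τ) {p q : Fin n}
    (hpq : p < q) (hp : τ p ≠ q) (hF : ∀ j, p < j → j < q → τ j = j) (i : Fin n) :
    SignType.sign (((Equiv.swap p q * τ * Equiv.swap p q) i : ℤ) - (i : ℤ)) =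
      SignType.sign ((τ (Equiv.swap p q i) : ℤ) - (Equiv.swap p q i : ℤ)) := by
  obtain ⟨j, rfl⟩ := (Equiv.swap p q).surjective i
  simp only [Equiv.Perm.mul_apply, Equiv.swap_apply_self]
  have hq : τ q ≠ p := fun h => hp (by rw [← h, hτ])
  have h2 : (p < τ j ∧ τ j < q) → τ j = j := fun hh => by
    have := hF _ hh.1 hh.2
    rw [hτ j] at this; exact this.symm
  have h1 : (p < j ∧ j < q) → τ j = j := fun hh => hF _ hh.1 hh.2
  rcases lt_trichotomy j (τ j) with h | h | h
  · rw [(sign_sub_eq_one_iff _ _).2 h, sign_sub_eq_one_iff]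
    exact swap_lt_swap hpq h (by grind) (by grind) (by grind)
  · rw [← h]; simp
  · rw [(sign_sub_eq_neg_one_iff _ _).2 h, sign_sub_eq_neg_one_iff]
    exact swap_lt_swap hpq h (by grind) (by grind) (by grind)

lemma coe_swap {n : ℕ} (p q i : Fin n) :
    ((Equiv.swap p q i : Fin n) : ℕ) = Equiv.swap (p : ℕ) (q : ℕ) (i : ℕ) := by
  simp only [Equiv.swap_apply_def, Fin.ext_iff]
  split_ifs <;> rfl

lemma involutive_conj {α : Type*} [DecidableEq α] {τ : Equiv.Perm α}
    (hτ : Function.Involutive τ) (p q : α) :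
    Function.Involutive (Equiv.swap p q * τ * Equiv.swap p q) := fun i => by
  simp [hτ (Equiv.swap p q i)]

lemma conj_conj {α : Type*} [DecidableEq α] (τ : Equiv.Perm α) (p q : α) :
    Equiv.swap p q * (Equiv.swap p q * τ * Equiv.swap p q) * Equiv.swap p q = τ := by
  ext i; simp

/-- Replace the values of `c` on the interval `[p, q]` by the constant `K`. -/
def setOn {α : Type*} (p q : ℕ) (K : α) (c : ℕ → α) (j : ℕ) : α :=
  if p ≤ j ∧ j ≤ q then K else c j

/-- Uncrossing the arcs at an opener and the next closer, when they belong to different arcs. -/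
lemma conj_mem_typedInvs {n : ℕ} {w : ℕ → SignType} {c : ℕ → ℕ} {p q : Fin n} (hpq : p < q)
    (hp : w p = 1) (hq : w q = -1) (hF : ∀ j : ℕ, p < j → j < q → w j = 0) {K : ℕ}
    (hK : ∃ j : ℕ, p ≤ j ∧ j ≤ q ∧ c j = K)
    {τ : Equiv.Perm (Fin n)} (hτ : τ ∈ typedInvs n w c) (hne : τ p ≠ q) :
    Equiv.swap p q * τ * Equiv.swap p q ∈
      typedInvs n (w ∘ Equiv.swap (p : ℕ) (q : ℕ)) (setOn p q K c) := by
  rw [mem_typedInvs] at hτ ⊢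
  obtain ⟨h1, h2, h3⟩ := hτ
  have hp' : p < τ p := by rw [← sign_sub_eq_one_iff, h2, hp]
  have hq' : τ q < q := by rw [← sign_sub_eq_neg_one_iff, h2, hq]
  have hF' : ∀ j, p < j → j < q → τ j = j := fun j ha hb => by
    rw [← sign_sub_eq_zero_iff, h2, hF j ha hb]
  have h6 : ∀ {j}, p < τ j → τ j < q → τ j = j := fun {j} ha hb => by
    have := hF' _ ha hb
    rw [h1 j] at this; exact this.symm
  have hqp : τ q ≠ p := fun h => hne (by rw [← h, h1])
  have hp'' : q < τ p := by grind
  have hq'' : τ q < p := by grind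
  obtain ⟨j₀, hj1, hj2, rfl⟩ := hK
  refine ⟨involutive_conj h1 p q, fun i => ?_, fun i hi => ?_⟩
  · rw [sign_conj h1 hpq hne hF', h2, coe_swap]; rfl
  · have key := nestAt_cross (involutive_conj h1 p q) hpq
      (by simp [Equiv.swap_apply_of_ne_of_ne hq''.ne (hq''.trans hpq).ne, hq''])
      (by simp [Equiv.swap_apply_of_ne_of_ne (hpq.trans hp'').ne' hp''.ne', hp''])
      (fun j ha hb => by
        simp [Equiv.swap_apply_of_ne_of_ne ha.ne' hb.ne, hF' j ha hb]) hi
    rw [conj_conj] at key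
    unfold setOn at key
    split_ifs at key with h
    · exact h3 ⟨j₀, by omega⟩ (key.move h1 hp' hq' hF' (by simpa using h)
        (by simp only [Fin.le_def]; omega))
    · exact h3 _ key

lemma conj_mem_typedInvs_symm {n : ℕ} {w : ℕ → SignType} {c : ℕ → ℕ} {p q : Fin n} (hpq : p < q)
    (hp : w p = 1) (hq : w q = -1) (hF : ∀ j : ℕ, p < j → j < q → w j = 0) {K : ℕ}
    (hK : ∀ j : ℕ, p ≤ j → j ≤ q → K ≤ c j)
    {τ : Equiv.Perm (Fin n)}
    (hτ : τ ∈ typedInvs n (w ∘ Equiv.swap (p : ℕ) (q : ℕ)) (setOn p q K c)) :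
    Equiv.swap p q * τ * Equiv.swap p q ∈ typedInvs n w c ∧
      (Equiv.swap p q * τ * Equiv.swap p q) p ≠ q := by
  rw [mem_typedInvs] at hτ ⊢
  obtain ⟨h1, h2, h3⟩ := hτ
  have hp' : τ p < p := by rw [← sign_sub_eq_neg_one_iff, h2]; simp [hq]
  have hq' : q < τ q := by rw [← sign_sub_eq_one_iff, h2]; simp [hp]
  have hF' : ∀ j, p < j → j < q → τ j = j := fun j ha hb => by
    rw [← sign_sub_eq_zero_iff, h2, Function.comp,
      Equiv.swap_apply_of_ne_of_ne (by omega) (by omega), hF j ha hb]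
  have hne : τ p ≠ q := by grind
  have e1 : q < (Equiv.swap p q * τ * Equiv.swap p q) p := by
    simp [Equiv.swap_apply_of_ne_of_ne (hpq.trans hq').ne' hq'.ne', hq']
  have e2 : (Equiv.swap p q * τ * Equiv.swap p q) q < p := by
    simp [Equiv.swap_apply_of_ne_of_ne hp'.ne (hp'.trans hpq).ne, hp']
  refine ⟨⟨involutive_conj h1 p q, fun i => ?_, fun i hi => ?_⟩, e1.ne'⟩
  · rw [sign_conj h1 hpq hne hF', h2, coe_swap]; simp
  · have key := nestAt_uncross (involutive_conj h1 p q) hpq e1 e2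
      (fun j ha hb => by
        simp [Equiv.swap_apply_of_ne_of_ne ha.ne' hb.ne, hF' j ha hb]) hi
    rw [conj_conj] at key
    have h4 : ∀ j : Fin n, setOn p q K c j ≤ c j := fun j => by
      unfold setOn; split_ifs with h
      · exact hK _ h.1 h.2
      · rfl
    have h5 : ∀ j : Fin n, p ≤ j ∧ j ≤ q → setOn p q K c j ≤ c i ∨ ¬ (p ≤ i ∧ i ≤ q) := by
      intro j hj
      by_cases h : p ≤ i ∧ i ≤ q
      · left
        unfold setOn
        rw [if_pos (by simpa using hj)]
        exact hK _ h.1 h.2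
      · exact .inr h
    rcases key with h | ⟨h, h' | h'⟩
    · exact h3 i (h.mono (h4 i))
    · exact h3 p (h'.mono ((h5 p ⟨le_rfl, hpq.le⟩).resolve_right (not_not.2 h)))
    · exact h3 q (h'.mono ((h5 q ⟨hpq.le, le_rfl⟩).resolve_right (not_not.2 h)))

lemma involutive_mul_swap {α : Type*} [DecidableEq α] {τ : Equiv.Perm α}
    (hτ : Function.Involutive τ) {p q : α} (h : Equiv.swap p q * τ = τ * Equiv.swap p q) :
    Function.Involutive (τ * Equiv.swap p q) := fun i => by
  conv_lhs => rw [← h]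
  rw [h]
  have := DFunLike.congr_fun h (Equiv.swap p q i)
  simp only [Equiv.Perm.mul_apply, Equiv.swap_apply_self] at this
  simp [this, hτ i]

/-- Removing the arc joining an opener to the next closer. -/
lemma mul_swap_mem_typedInvs_iff {n : ℕ} {w : ℕ → SignType} {c : ℕ → ℕ} {p q : Fin n} (hpq : p < q)
    (hp : w p = 1) (hq : w q = -1) (hF : ∀ j : ℕ, p < j → j < q → w j = 0) {K : ℕ}
    (hK : ∀ j : ℕ, p ≤ j → j ≤ q → K ≤ c j) (hK' : ∃ j : ℕ, p ≤ j ∧ j ≤ q ∧ c j = K)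
    {τ : Equiv.Perm (Fin n)} (h1 : Function.Involutive τ) (hτp : τ p = p) (hτq : τ q = q) :
    τ * Equiv.swap p q ∈ typedInvs n w c ↔
      τ ∈ typedInvs n (setOn p q 0 w) (setOn p q (K - 1) c) := by
  have hin : Function.Involutive (τ * Equiv.swap p q) := by
    apply involutive_mul_swap h1
    rw [Equiv.mul_swap_eq_swap_mul, hτp, hτq]
  have key : ∀ j, j ≠ p → j ≠ q → (τ * Equiv.swap p q) j = τ j := fun j h1 h2 => by
    simp [Equiv.swap_apply_of_ne_of_ne h1 h2]
  have kp : (τ * Equiv.swap p q) p = q := by simp [hτq]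
  have kq : (τ * Equiv.swap p q) q = p := by simp [hτp]
  rw [mem_typedInvs, mem_typedInvs]
  simp only [hin, h1, true_and]
  have hty : (∀ i : Fin n, SignType.sign (((τ * Equiv.swap p q) i : ℤ) - (i : ℤ)) = w i) ↔
      ∀ i : Fin n, SignType.sign ((τ i : ℤ) - (i : ℤ)) = setOn p q 0 w i := by
    refine forall_congr' fun i => ?_
    unfold setOn
    by_cases hip : i = p
    · subst hip
      rw [kp, hp, if_pos ⟨le_rfl, hpq.le⟩, sign_sub_eq_one_iff, sign_sub_eq_zero_iff]
      simp [hτp, hpq]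
    by_cases hiq : i = q
    · subst hiq
      rw [kq, hq, if_pos ⟨hpq.le, le_rfl⟩, sign_sub_eq_neg_one_iff, sign_sub_eq_zero_iff]
      simp [hτq, hpq]
    rw [key i hip hiq]
    split_ifs with h
    · rw [hF i (by omega) (by omega)]
    · rfl
  rw [hty]
  refine and_congr_right fun h2 => ?_
  have hF' : ∀ j, p ≤ j → j ≤ q → τ j = j := fun j ha hb => by
    rw [← sign_sub_eq_zero_iff, h2, setOn, if_pos ⟨ha, hb⟩]
  have hF'' : ∀ j, p < j → j < q → (τ * Equiv.swap p q) j = j := fun j ha hb => by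
    rw [key j ha.ne' hb.ne, hF' j ha.le hb.le]
  constructor
  · intro h i hi
    unfold setOn at hi
    split_ifs at hi with hpi
    · obtain ⟨j₀, hj1, hj2, rfl⟩ := hK'
      rw [← nestAt_mul_swap_iff_of_mem h1 hpq hF' (by simpa using hpi)] at hi
      exact h ⟨j₀, by omega⟩ (hi.move hin (by rw [kp]; exact hpq) (by rw [kq]; exact hpq) hF''
        (by simpa using hpi) (by simp only [Fin.le_def]; omega))
    · rw [← nestAt_mul_swap_iff hpq hτp hτq (by simpa using hpi)] at hi
      exact h i hi
  · intro h i hi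
    by_cases hpi : p ≤ i ∧ i ≤ q
    · rw [nestAt_mul_swap_iff_of_mem h1 hpq hF' hpi] at hi
      refine h i (hi.mono ?_)
      rw [setOn, if_pos (by simpa using hpi)]
      exact Nat.sub_le_sub_right (hK _ hpi.1 hpi.2) 1
    · rw [nestAt_mul_swap_iff hpq hτp hτq hpi] at hi
      refine h i ?_
      rwa [setOn, if_neg (by simpa using hpi)]

/-- The growth recursion for involutions of prescribed type. -/
lemma card_typedInvs_rec {n : ℕ} {w : ℕ → SignType} {c : ℕ → ℕ} {p q : Fin n} (hpq : p < q)
    (hp : w p = 1) (hq : w q = -1) (hF : ∀ j : ℕ, p < j → j < q → w j = 0) {K : ℕ}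
    (hK : ∀ j : ℕ, p ≤ j → j ≤ q → K ≤ c j) (hK' : ∃ j : ℕ, p ≤ j ∧ j ≤ q ∧ c j = K) :
    (typedInvs n w c).card =
      (typedInvs n (w ∘ Equiv.swap (p : ℕ) (q : ℕ)) (setOn p q K c)).card +
      (typedInvs n (setOn p q 0 w) (setOn p q (K - 1) c)).card := by
  rw [← Finset.card_filter_add_card_filter_not (s := typedInvs n w c) (fun τ => τ p ≠ q)]
  congr 1
  · refine Finset.card_nbij' (fun τ => Equiv.swap p q * τ * Equiv.swap p q)
      (fun τ => Equiv.swap p q * τ * Equiv.swap p q) ?_ ?_ ?_ ?_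
    · intro τ hτ
      simp only [Finset.coe_filter, Set.mem_ofPred_eq] at hτ
      exact conj_mem_typedInvs hpq hp hq hF hK' hτ.1 hτ.2
    · intro τ hτ
      simp only [Finset.coe_filter, Set.mem_ofPred_eq]
      exact conj_mem_typedInvs_symm hpq hp hq hF hK hτ
    · intro τ _; exact conj_conj τ p q
    · intro τ _; exact conj_conj τ p q
  · refine Finset.card_nbij' (fun τ => τ * Equiv.swap p q)
      (fun τ => τ * Equiv.swap p q) ?_ ?_ ?_ ?_
    · intro τ hτ
      simp only [Finset.coe_filter, Set.mem_ofPred_eq, not_not] at hτ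
      have hi := (mem_typedInvs.1 hτ.1).1
      have hqp : τ q = p := by rw [← hτ.2, hi]
      refine (mul_swap_mem_typedInvs_iff hpq hp hq hF hK hK' ?_ ?_ ?_).1 ?_
      · apply involutive_mul_swap hi
        rw [Equiv.mul_swap_eq_swap_mul, hτ.2, hqp, Equiv.swap_comm]
      · simp [hqp]
      · simp [hτ.2]
      · simpa [mul_assoc] using hτ.1
    · intro τ hτ
      have h2 := (mem_typedInvs.1 hτ).2.1
      have hτp : τ p = p := by
        rw [← sign_sub_eq_zero_iff, h2, setOn, if_pos ⟨le_rfl, hpq.le⟩]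
      have hτq : τ q = q := by
        rw [← sign_sub_eq_zero_iff, h2, setOn, if_pos ⟨hpq.le, le_rfl⟩]
      simp only [Finset.coe_filter, Set.mem_ofPred_eq, not_not]
      exact ⟨(mul_swap_mem_typedInvs_iff hpq hp hq hF hK hK' (mem_typedInvs.1 hτ).1 hτp hτq).2 hτ,
        by simp [hτq]⟩
    · intro τ _; simp [mul_assoc]
    · intro τ _; simp [mul_assoc]

/-- `h` is the sequence of column heights of a Young diagram with fewer than `k` columns. -/
def IsShape (k : ℕ) (h : ℕ → ℕ) : Prop :=
  Antitone h ∧ ∃ i < k, h i = 0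

/-- Restriction of a function to shapes with fewer than `k` columns. -/
def restr (k : ℕ) (f : (ℕ → ℕ) → ℚ) (h : ℕ → ℕ) : ℚ :=
  if IsShape k h then f h else 0

/-- Transfer operators: add a cell to, delete a cell from, or keep a diagram with `ℓ` columns. -/
def move (ℓ : ℕ) (s : SignType) (f : (ℕ → ℕ) → ℚ) (h : ℕ → ℕ) : ℚ :=
  if s = 1 then ∑ i ∈ Finset.range ℓ, if 0 < h i then f (h - Pi.single i 1) else 0
  else if s = 0 then f h
  else ∑ i ∈ Finset.range ℓ, f (h + Pi.single i 1)

/-- Number of walks on Young diagrams of type `w` with column bounds `c`, by end point. -/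
def walk (ℓ : ℕ) (w : ℕ → SignType) (c : ℕ → ℕ) : ℕ → (ℕ → ℕ) → ℚ
  | 0 => fun h => if h = 0 then 1 else 0
  | j + 1 => restr (c j) (move ℓ (w j) (restr (c j) (walk ℓ w c j)))

lemma IsShape.mono {k l : ℕ} {h : ℕ → ℕ} (hh : IsShape k h) (hkl : k ≤ l) : IsShape l h :=
  ⟨hh.1, hh.2.imp fun _ hi => ⟨hi.1.trans_le hkl, hi.2⟩⟩

lemma isShape_succ {k : ℕ} {h : ℕ → ℕ} :
    IsShape (k + 1) h ↔ (∀ n, h (n + 1) ≤ h n) ∧ h k = 0 := by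
  constructor
  · rintro ⟨h1, i, hi, h2⟩
    exact ⟨fun n => h1 (Nat.le_succ n), Nat.le_zero.1 (h2 ▸ h1 (Nat.lt_succ_iff.1 hi))⟩
  · rintro ⟨h1, h2⟩
    exact ⟨antitone_nat_of_succ_le h1, k, Nat.lt_succ_self k, h2⟩

lemma not_isShape_zero (h : ℕ → ℕ) : ¬ IsShape 0 h := by
  rintro ⟨_, i, hi, _⟩
  exact absurd hi (Nat.not_lt_zero i)

lemma isShape_zero_right {k : ℕ} : IsShape k 0 ↔ 0 < k :=
  ⟨fun ⟨_, _, hi, _⟩ => (Nat.zero_le _).trans_lt hi, fun hk => ⟨antitone_const, 0, hk, rfl⟩⟩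

lemma isShape_add_iff {k i : ℕ} {h : ℕ → ℕ} (hh : IsShape (k + 1) h) :
    IsShape (k + 1) (h + Pi.single i 1) ↔ i < k ∧ (i = 0 ∨ h i < h (i - 1)) := by
  have hz : ∀ n, k ≤ n → h n = 0 := fun n hn => by
    have := hh.1 hn
    have := (isShape_succ.1 hh).2
    omega
  rw [isShape_succ] at hh ⊢
  obtain ⟨h1, h2⟩ := hh
  simp only [Pi.add_apply, Pi.single_apply]
  constructor
  · rintro ⟨h3, h4⟩
    have h5 : k ≠ i := by intro h; simp [h] at h4
    rcases Nat.eq_zero_or_pos i with rfl | hi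
    · exact ⟨by omega, .inl rfl⟩
    · have := h3 (i - 1)
      rw [Nat.sub_add_cancel hi, if_pos rfl, if_neg (by omega)] at this
      refine ⟨?_, .inr (by omega)⟩
      by_contra hki
      have := hz (i - 1) (by omega)
      omega
  · rintro ⟨h3, h4⟩
    refine ⟨fun n => ?_, ?_⟩
    · have := h1 n
      by_cases hn : n + 1 = i
      · subst hn
        simp at h4 ⊢
        omega
      · rw [if_neg hn]; omega
    · rw [if_neg (by omega), h2, add_zero]

lemma isShape_sub_iff {k i : ℕ} {h : ℕ → ℕ} (hh : IsShape (k + 1) h) :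
    (0 < h i ∧ IsShape (k + 1) (h - Pi.single i 1)) ↔ h (i + 1) < h i := by
  rw [isShape_succ] at hh ⊢
  obtain ⟨h1, h2⟩ := hh
  simp only [Pi.sub_apply, Pi.single_apply]
  constructor
  · rintro ⟨h3, h4, h5⟩
    have := h4 i
    simp at this
    omega
  · intro h3
    refine ⟨by omega, fun n => ?_, by omega⟩
    have := h1 n
    by_cases hn : n = i
    · subst hn
      simp; omega
    · rw [if_neg hn]; omega

lemma isShape_of_exchange {K i j : ℕ} {h : ℕ → ℕ} (hij : i ≠ j) (hh : IsShape K h)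
    (hj : 0 < h j) (hg : IsShape K (h + Pi.single i 1 - Pi.single j 1)) :
    IsShape K (h + Pi.single i 1) ∧ IsShape K (h - Pi.single j 1) := by
  cases K with
  | zero => exact absurd hh (not_isShape_zero h)
  | succ k =>
    simp only [isShape_succ] at *
    simp only [Pi.add_apply, Pi.sub_apply, Pi.single_apply] at *
    obtain ⟨⟨hh1, hh2⟩, hg1, hg2⟩ := And.intro hh hg
    have hj' : ∀ n, n = j → 0 < h n := by rintro _ rfl; exact hj
    refine ⟨⟨fun n => ?_, ?_⟩, fun n => ?_, ?_⟩
    · have h1 := hh1 n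
      have h2 := hg1 n
      have h3 := hj' n
      have h4 := hj' (n + 1)
      split_ifs at h2 ⊢ <;> omega
    · have h4 := hj' k
      split_ifs at hg2 ⊢ <;> omega
    · have h1 := hh1 n
      have h2 := hg1 n
      have h3 := hj' n
      have h4 := hj' (n + 1)
      split_ifs at h2 ⊢ <;> omega
    · omega

/-- Addable minus removable columns of a shape. -/
lemma sum_addable_sub_removable {ℓ K : ℕ} (hK : K ≤ ℓ + 1) {h : ℕ → ℕ} (hh : IsShape K h) :
    ∑ i ∈ Finset.range ℓ, ((if IsShape K (h + Pi.single i 1) then (1 : ℚ) else 0) -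
      if 0 < h i ∧ IsShape K (h - Pi.single i 1) then 1 else 0) =
      if IsShape (K - 1) h then 1 else 0 := by
  cases K with
  | zero => exact absurd hh (not_isShape_zero h)
  | succ k =>
    simp_rw [isShape_add_iff hh, isShape_sub_iff hh]
    have hz : ∀ n, k ≤ n → h n = 0 := fun n hn => by
      have := hh.1 hn
      have := (isShape_succ.1 hh).2
      omega
    have hsub : Finset.range k ⊆ Finset.range ℓ := Finset.range_mono (by omega)
    rw [← Finset.sum_subset hsub fun i _ hi => by
      have hi : k ≤ i := by simpa using hi
      rw [if_neg (by omega), if_neg (by rw [hz i hi]; omega), sub_zero]]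
    cases k with
    | zero => simp [not_isShape_zero]
    | succ m =>
      rw [Finset.sum_sub_distrib, Finset.sum_range_succ', Finset.sum_range_succ]
      have : ∀ i ∈ Finset.range m,
          (if i + 1 < m + 1 ∧ (i + 1 = 0 ∨ h (i + 1) < h (i + 1 - 1)) then (1 : ℚ) else 0) =
          if h (i + 1) < h i then 1 else 0 := fun i hi => by
        have : i < m := by simpa using hi
        simp [this]
      rw [Finset.sum_congr rfl this, hz (m + 1) le_rfl]
      have h1 : IsShape (m + 1 + 1 - 1) h ↔ h m = 0 := by
        rw [Nat.add_sub_cancel, isShape_succ]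
        exact and_iff_right fun n => hh.1 (Nat.le_succ n)
      simp only [h1]
      by_cases hm : h m = 0 <;> simp [hm, Nat.pos_iff_ne_zero]

lemma move_one (ℓ : ℕ) (f : (ℕ → ℕ) → ℚ) (h : ℕ → ℕ) :
    move ℓ 1 f h = ∑ i ∈ Finset.range ℓ, if 0 < h i then f (h - Pi.single i 1) else 0 := by
  simp [move]

lemma move_zero (ℓ : ℕ) (f : (ℕ → ℕ) → ℚ) : move ℓ 0 f = f := by
  ext h; simp [move]

lemma move_neg_one (ℓ : ℕ) (f : (ℕ → ℕ) → ℚ) (h : ℕ → ℕ) :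
    move ℓ (-1) f h = ∑ i ∈ Finset.range ℓ, f (h + Pi.single i 1) := by
  simp [move]

/-- The commutation relation between adding and deleting cells in bounded shapes. -/
lemma restr_move_comm {ℓ K : ℕ} (hK : K ≤ ℓ + 1) (f : (ℕ → ℕ) → ℚ) :
    restr K (move ℓ (-1) (restr K (move ℓ 1 (restr K f)))) =
      restr K (move ℓ 1 (restr K (move ℓ (-1) (restr K f)))) + restr (K - 1) f := by
  ext h
  rw [Pi.add_apply]
  by_cases hh : IsShape K h
  swap
  · have : ¬ IsShape (K - 1) h := fun h' => hh (h'.mono (Nat.sub_le K 1))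
    simp [restr, hh, this]
  rw [restr, if_pos hh, restr, if_pos hh, move_neg_one, move_one]
  simp only [restr, move_one, move_neg_one]
  have hL : ∀ i ∈ Finset.range ℓ, (if IsShape K (h + Pi.single i 1) then
      ∑ j ∈ Finset.range ℓ, (if 0 < (h + Pi.single i 1 : ℕ → ℕ) j then
        if IsShape K (h + Pi.single i 1 - Pi.single j 1) then
          f (h + Pi.single i 1 - Pi.single j 1) else 0 else 0) else 0) =
      ∑ j ∈ Finset.range ℓ, if IsShape K (h + Pi.single i 1) then
        (if 0 < (h + Pi.single i 1 : ℕ → ℕ) j then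
        if IsShape K (h + Pi.single i 1 - Pi.single j 1) then
          f (h + Pi.single i 1 - Pi.single j 1) else 0 else 0) else 0 := fun i _ => by
    split_ifs <;> simp
  have hR : ∀ j ∈ Finset.range ℓ, (if 0 < h j then if IsShape K (h - Pi.single j 1) then
      ∑ i ∈ Finset.range ℓ, (if IsShape K (h - Pi.single j 1 + Pi.single i 1) then
          f (h - Pi.single j 1 + Pi.single i 1) else 0) else 0 else 0) =
      ∑ i ∈ Finset.range ℓ, if 0 < h j then if IsShape K (h - Pi.single j 1) then
        (if IsShape K (h - Pi.single j 1 + Pi.single i 1) then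
          f (h - Pi.single j 1 + Pi.single i 1) else 0) else 0 else 0 := fun i _ => by
    split_ifs <;> simp
  rw [Finset.sum_congr rfl hL, Finset.sum_congr rfl hR]
  conv_rhs => arg 1; rw [Finset.sum_comm]
  rw [← sub_eq_iff_eq_add', ← Finset.sum_sub_distrib]
  have hcount : (if IsShape (K - 1) h then f h else 0) =
      (if IsShape (K - 1) h then 1 else 0) * f h := by split_ifs <;> simp
  rw [hcount, ← sum_addable_sub_removable hK hh, Finset.sum_mul]
  refine Finset.sum_congr rfl fun i hi => ?_
  rw [← Finset.sum_sub_distrib, Finset.sum_eq_single_of_mem i hi]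
  · have e1 : h + Pi.single i 1 - Pi.single i 1 = h := by ext; simp
    have e2 : 0 < h i → h - Pi.single i 1 + Pi.single i 1 = h := fun hi => by
      ext x
      simp only [Pi.add_apply, Pi.sub_apply, Pi.single_apply]
      split_ifs with hx
      · subst hx; omega
      · omega
    rw [e1]
    by_cases hi0 : 0 < h i
    · rw [e2 hi0]
      simp only [hh, hi0, if_true, true_and, sub_mul, ite_mul, one_mul, zero_mul]
      simp
    · simp [hh, hi0]
  · intro j _ hji
    have e0 : (h + Pi.single i 1 : ℕ → ℕ) j = h j := by simp [hji]
    have e1 : 0 < h j → h + Pi.single i 1 - Pi.single j 1 = h - Pi.single j 1 + Pi.single i 1 :=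
      fun hj => by
        ext x
        simp only [Pi.add_apply, Pi.sub_apply, Pi.single_apply]
        split_ifs <;> omega
    rw [e0]
    by_cases hj : 0 < h j
    · rw [← e1 hj]
      by_cases hg : IsShape K (h + Pi.single i 1 - Pi.single j 1)
      · have := isShape_of_exchange (Ne.symm hji) hh hj hg
        simp [hg, this.1, this.2]
      · simp [hg]
    · simp [hj]

lemma restr_add (k : ℕ) (f g : (ℕ → ℕ) → ℚ) : restr k (f + g) = restr k f + restr k g := by
  ext h
  simp only [restr, Pi.add_apply]
  split_ifs <;> simp

lemma move_add (ℓ : ℕ) (s : SignType) (f g : (ℕ → ℕ) → ℚ) :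
    move ℓ s (f + g) = move ℓ s f + move ℓ s g := by
  ext h
  simp only [move, Pi.add_apply]
  split_ifs
  · rw [← Finset.sum_add_distrib]
    exact Finset.sum_congr rfl fun i _ => by split_ifs <;> simp
  · rfl
  · rw [← Finset.sum_add_distrib]

lemma restr_zero (k : ℕ) : restr k 0 = 0 := by
  ext h; simp [restr]

lemma move_zero_right (ℓ : ℕ) (s : SignType) : move ℓ s 0 = 0 := by
  ext h; simp [move]

lemma walk_succ (ℓ : ℕ) (w : ℕ → SignType) (c : ℕ → ℕ) (j : ℕ) :
    walk ℓ w c (j + 1) = restr (c j) (move ℓ (w j) (restr (c j) (walk ℓ w c j))) := rfl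

lemma walk_congr {ℓ : ℕ} {w w' : ℕ → SignType} {c c' : ℕ → ℕ} {n : ℕ}
    (hw : ∀ j < n, w j = w' j) (hc : ∀ j < n, c j = c' j) : walk ℓ w c n = walk ℓ w' c' n := by
  induction n with
  | zero => rfl
  | succ n ih =>
    rw [walk_succ, walk_succ, hw n (by omega), hc n (by omega),
      ih (fun j hj => hw j (by omega)) fun j hj => hc j (by omega)]

lemma walk_add {ℓ : ℕ} {w w' w'' : ℕ → SignType} {c c' c'' : ℕ → ℕ} {a b : ℕ} (hab : a ≤ b)
    (hw' : ∀ j, a ≤ j → w' j = w j) (hw'' : ∀ j, a ≤ j → w'' j = w j)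
    (hc' : ∀ j, a ≤ j → c' j = c j) (hc'' : ∀ j, a ≤ j → c'' j = c j)
    (h : walk ℓ w c a = walk ℓ w' c' a + walk ℓ w'' c'' a) :
    walk ℓ w c b = walk ℓ w' c' b + walk ℓ w'' c'' b := by
  induction b, hab using Nat.le_induction with
  | base => exact h
  | succ b hab ih =>
    rw [walk_succ, walk_succ, walk_succ, ih, hw' b hab, hw'' b hab, hc' b hab, hc'' b hab,
      restr_add, move_add, restr_add]

lemma walk_eq_zero {ℓ : ℕ} {w : ℕ → SignType} {c : ℕ → ℕ} {a b : ℕ} (hab : a ≤ b)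
    (h : walk ℓ w c a = 0) : walk ℓ w c b = 0 := by
  induction b, hab using Nat.le_induction with
  | base => exact h
  | succ b hab ih => rw [walk_succ, ih, restr_zero, move_zero_right, restr_zero]

lemma walk_stay {ℓ : ℕ} {w : ℕ → SignType} {c : ℕ → ℕ} {a b : ℕ} (hab : a ≤ b)
    (hw : ∀ j, a ≤ j → j < b → w j = 0) (h : ℕ → ℕ) :
    walk ℓ w c b h =
      if ∀ i, a ≤ i → i < b → IsShape (c i) h then walk ℓ w c a h else 0 := by
  induction b, hab using Nat.le_induction with
  | base => rw [if_pos fun i h1 h2 => absurd h1 (by omega)]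
  | succ b hab ih =>
    rw [walk_succ, hw b hab (by omega), move_zero, restr, restr,
      ih fun j h1 h2 => hw j h1 (by omega)]
    by_cases hb : IsShape (c b) h
    · rw [if_pos hb, if_pos hb]
      refine if_congr ⟨fun H i h1 h2 => ?_, fun H i h1 h2 => H i h1 (by omega)⟩ rfl rfl
      rcases Nat.lt_succ_iff_lt_or_eq.1 h2 with h3 | rfl
      exacts [H i h1 h3, hb]
    · rw [if_neg hb, if_neg fun H => hb (H b hab (by omega))]

/-- A walk which stands still strictly between two steps. -/
lemma walk_pass {ℓ : ℕ} {w : ℕ → SignType} {c : ℕ → ℕ} {p q K : ℕ} (hpq : p < q)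
    (hF : ∀ j : ℕ, p < j → j < q → w j = 0)
    (hK : ∀ j : ℕ, p ≤ j → j ≤ q → K ≤ c j) (hK' : ∃ j : ℕ, p ≤ j ∧ j ≤ q ∧ c j = K) :
    walk ℓ w c (q + 1) = restr (c q) (move ℓ (w q) (restr K (move ℓ (w p)
      (restr (c p) (walk ℓ w c p))))) := by
  rw [walk_succ]
  congr 2
  ext h
  rw [restr, walk_stay hpq fun j h1 h2 => hF j (by omega) h2, walk_succ]
  by_cases hh : IsShape K h
  · have H : ∀ j, p ≤ j → j ≤ q → IsShape (c j) h := fun j h1 h2 => hh.mono (hK j h1 h2)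
    rw [if_pos (H q hpq.le le_rfl), if_pos fun j h1 h2 => H j (by omega) h2.le, restr,
      if_pos (H p le_rfl hpq.le), restr, if_pos hh]
  · rw [restr, restr, if_neg hh]
    by_contra hne
    split_ifs at hne with h1 h2 h3
    all_goals try exact hne rfl
    obtain ⟨j, hj1, hj2, rfl⟩ := hK'
    rcases eq_or_lt_of_le hj1 with rfl | hj3
    · exact hh h3
    · rcases eq_or_lt_of_le hj2 with rfl | hj4
      · exact hh h1
      · exact hh (h2 j hj3 hj4)

lemma restr_move_one_restr {ℓ K a : ℕ} (hK : K ≤ a) (f : (ℕ → ℕ) → ℚ) :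
    restr K (move ℓ 1 (restr a f)) = restr K (move ℓ 1 (restr K f)) := by
  ext h
  rw [restr, restr]
  split_ifs with hh
  · rw [move_one, move_one]
    refine Finset.sum_congr rfl fun i _ => ?_
    split_ifs with hi
    · refine if_congr ⟨fun H => ?_, fun H => H.mono hK⟩ rfl rfl
      obtain ⟨j, hj, h0⟩ := hh.2
      exact ⟨H.1, j, hj, by simp [h0]⟩
    · rfl
  · rfl

lemma restr_move_neg_one_restr {ℓ K a : ℕ} (hK : K ≤ a) (f : (ℕ → ℕ) → ℚ) :
    restr a (move ℓ (-1) (restr K f)) = restr K (move ℓ (-1) (restr K f)) := by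
  ext h
  rw [restr, restr]
  by_cases hh : IsShape K h
  · rw [if_pos hh, if_pos (hh.mono hK)]
  · rw [if_neg hh, ite_eq_right_iff]
    intro ha
    rw [move_neg_one]
    refine Finset.sum_eq_zero fun i _ => if_neg fun H => hh ⟨ha.1, ?_⟩
    obtain ⟨j, hj, h0⟩ := H.2
    exact ⟨j, hj, (Nat.add_eq_zero_iff.1 h0).1⟩

lemma setOn_of_mem {α : Type*} {p q j : ℕ} (K : α) (c : ℕ → α) (h1 : p ≤ j) (h2 : j ≤ q) :
    setOn p q K c j = K := if_pos ⟨h1, h2⟩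

lemma setOn_of_lt {α : Type*} {p q j : ℕ} (K : α) (c : ℕ → α) (h1 : j < p) :
    setOn p q K c j = c j := if_neg (by omega)

lemma setOn_of_gt {α : Type*} {p q j : ℕ} (K : α) (c : ℕ → α) (h1 : q < j) :
    setOn p q K c j = c j := if_neg (by omega)

lemma walk_rec {ℓ n p q K : ℕ} {w : ℕ → SignType} {c : ℕ → ℕ} (hqn : q < n) (hpq : p < q)
    (hp : w p = 1) (hq : w q = -1) (hF : ∀ j : ℕ, p < j → j < q → w j = 0)
    (hK : ∀ j : ℕ, p ≤ j → j ≤ q → K ≤ c j) (hK' : ∃ j : ℕ, p ≤ j ∧ j ≤ q ∧ c j = K)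
    (hKl : K ≤ ℓ + 1) :
    walk ℓ w c n = walk ℓ (w ∘ Equiv.swap p q) (setOn p q K c) n +
      walk ℓ (setOn p q 0 w) (setOn p q (K - 1) c) n := by
  have hsw : ∀ j, j ≠ p → j ≠ q → (w ∘ Equiv.swap p q) j = w j := fun j h1 h2 => by
    simp [Equiv.swap_apply_of_ne_of_ne h1 h2]
  refine walk_add hqn (fun j hj => hsw j (by omega) (by omega))
    (fun j hj => setOn_of_gt _ _ (by omega)) (fun j hj => setOn_of_gt _ _ (by omega))
    (fun j hj => setOn_of_gt _ _ (by omega)) ?_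
  rw [walk_pass hpq hF hK hK',
    walk_pass (K := K) hpq (fun j h1 h2 => (hsw j (by omega) (by omega)).trans (hF j h1 h2))
      (fun j h1 h2 => (setOn_of_mem K c h1 h2).ge) ⟨p, le_rfl, hpq.le, setOn_of_mem K c le_rfl hpq.le⟩,
    walk_pass (K := K - 1) hpq (fun j h1 h2 => setOn_of_mem _ _ h1.le h2.le)
      (fun j h1 h2 => (setOn_of_mem _ c h1 h2).ge) ⟨p, le_rfl, hpq.le, setOn_of_mem _ c le_rfl hpq.le⟩]
  rw [walk_congr (w' := w) (c' := c) (n := p) (fun j hj => hsw j (by omega) (by omega))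
      (fun j hj => setOn_of_lt _ _ hj),
    walk_congr (w' := w) (c' := c) (n := p) (fun j hj => setOn_of_lt _ _ hj)
      (fun j hj => setOn_of_lt _ _ hj)]
  simp only [setOn_of_mem _ _ hpq.le le_rfl, setOn_of_mem _ _ le_rfl hpq.le, hp, hq,
    Function.comp_apply, Equiv.swap_apply_left, Equiv.swap_apply_right, move_zero]
  rw [restr_move_one_restr (hK p le_rfl hpq.le), restr_move_neg_one_restr (hK q hpq.le le_rfl),
    restr_move_comm hKl]
  congr 1
  ext h
  simp only [restr]
  split_ifs <;> rfl

/-- A weight on arc types that decreases under the recursion. -/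
def typeWeight (n : ℕ) (w : ℕ → SignType) : ℕ :=
  ∑ i : Fin n, if w i = 1 then n - i else 0

lemma typeWeight_comp_swap_lt {n : ℕ} {w : ℕ → SignType} {p q : Fin n} (hpq : p < q)
    (hp : w p = 1) (hq : w q = -1) :
    typeWeight n (w ∘ Equiv.swap (p : ℕ) (q : ℕ)) < typeWeight n w := by
  unfold typeWeight
  rw [← Equiv.sum_comp (Equiv.swap p q)]
  simp only [Function.comp_apply, coe_swap, Equiv.swap_apply_self]
  refine Finset.sum_lt_sum (fun i _ => ?_) ⟨p, Finset.mem_univ _, ?_⟩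
  · split_ifs with h
    · by_cases hip : i = p
      · subst hip
        rw [Equiv.swap_apply_left]; omega
      · have hiq : i ≠ q := by
          rintro rfl
          rw [hq] at h
          exact absurd h (by decide)
        rw [Equiv.swap_apply_of_ne_of_ne (by omega) (by omega)]
    · exact le_rfl
  · rw [if_pos hp, if_pos hp, Equiv.swap_apply_left]; omega

lemma typeWeight_setOn_lt {n : ℕ} {w : ℕ → SignType} {p q : Fin n} (hpq : p < q)
    (hp : w p = 1) : typeWeight n (setOn p q 0 w) < typeWeight n w := by
  refine Finset.sum_lt_sum (fun i _ => ?_) ⟨p, Finset.mem_univ _, ?_⟩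
  · by_cases h : (p : ℕ) ≤ i ∧ (i : ℕ) ≤ q
    · rw [setOn_of_mem _ _ h.1 h.2, if_neg (by decide)]; omega
    · rw [setOn, if_neg h]
  · rw [if_pos hp, setOn_of_mem _ _ le_rfl (by omega), if_neg (by decide)]; omega

lemma typedInvs_apply_type {n : ℕ} {w : ℕ → SignType} {c : ℕ → ℕ} {τ : Equiv.Perm (Fin n)}
    (hτ : τ ∈ typedInvs n w c) (i : Fin n) :
    (w i = 1 → i < τ i ∧ w (τ i : Fin n) = -1) ∧ (w i = -1 → τ i < i ∧ w (τ i : Fin n) = 1) := by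
  rw [mem_typedInvs] at hτ
  obtain ⟨h1, h2, _⟩ := hτ
  rw [← h2 i, ← h2 (τ i), h1 i]
  simp only [sign_sub_eq_one_iff, sign_sub_eq_neg_one_iff]
  exact ⟨fun h => ⟨h, h⟩, fun h => ⟨h, h⟩⟩

lemma typedInvs_zero_card {n : ℕ} {w : ℕ → SignType} {c : ℕ → ℕ} (hw : ∀ i < n, w i = 0) :
    (typedInvs n w c).card = if ∀ i < n, 0 < c i then 1 else 0 := by
  have key : ∀ τ ∈ typedInvs n w c, τ = 1 := fun τ hτ => by
    ext i
    rw [mem_typedInvs] at hτ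
    have := (hτ.2.1 i).trans (hw i i.2)
    rw [sign_sub_eq_zero_iff] at this
    rw [this, Equiv.Perm.one_apply]
  split_ifs with hc
  · rw [Finset.card_eq_one]
    refine ⟨1, Finset.eq_singleton_iff_unique_mem.2 ⟨?_, key⟩⟩
    rw [mem_typedInvs]
    refine ⟨fun i => rfl, fun i => ?_, ?_⟩
    · rw [hw i i.2, sign_sub_eq_zero_iff, Equiv.Perm.one_apply]
    · rintro i ⟨A, hA, h1, -⟩
      obtain ⟨a, ha⟩ := Finset.card_pos.1 ((hc i i.2).trans_le hA)
      exact lt_irrefl a (h1 a ha).2.2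
  · rw [Finset.card_eq_zero, Finset.eq_empty_iff_forall_notMem]
    intro τ hτ
    push Not at hc
    obtain ⟨i, hi, h0⟩ := hc
    exact (mem_typedInvs.1 hτ).2.2 ⟨i, hi⟩ ⟨∅, by simpa using h0, by simp, by simp⟩

/-- Involutions of a given type with bounded nestings are equinumerous with closed walks on
Young diagrams with bounded numbers of columns. -/
theorem card_typedInvs_eq_walk (ℓ n : ℕ) (w : ℕ → SignType) (c : ℕ → ℕ) (hc : ∀ j, c j ≤ ℓ + 1) :
    ((typedInvs n w c).card : ℚ) = walk ℓ w c n 0 := by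
  induction hN : typeWeight n w using Nat.strong_induction_on generalizing w c with
  | _ N ih =>
  subst hN
  by_cases hU : ∃ p : Fin n, w p = 1
  · obtain ⟨p, hp, hmax⟩ : ∃ p : Fin n, w p = 1 ∧ ∀ j : Fin n, p < j → w j ≠ 1 := by
      have hne : (Finset.univ.filter fun p : Fin n => w p = 1).Nonempty := by
        simpa [Finset.Nonempty] using hU
      refine ⟨_, (Finset.mem_filter.1 (Finset.max'_mem _ hne)).2, fun j hj h => ?_⟩
      exact absurd (Finset.le_max' _ j (by simp [h])) (not_le.2 hj)
    by_cases hD : ∃ q : Fin n, p < q ∧ w q = -1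
    · obtain ⟨q, ⟨hpq, hq⟩, hmin⟩ : ∃ q : Fin n, (p < q ∧ w q = -1) ∧
          ∀ j : Fin n, j < q → ¬ (p < j ∧ w j = -1) := by
        have hne : (Finset.univ.filter fun q : Fin n => p < q ∧ w q = -1).Nonempty := by
          simpa [Finset.Nonempty] using hD
        refine ⟨_, (Finset.mem_filter.1 (Finset.min'_mem _ hne)).2, fun j hj h => ?_⟩
        exact absurd (Finset.min'_le _ j (by simp [h])) (not_le.2 hj)
      have hF : ∀ j : ℕ, p < j → j < q → w j = 0 := fun j h1 h2 => by
        have h3 := hmax ⟨j, h2.trans q.2⟩ h1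
        have h4 := hmin ⟨j, h2.trans q.2⟩ h2
        have h5 : w j ≠ -1 := fun h => h4 ⟨h1, h⟩
        revert h3 h5
        generalize w j = x
        decide +revert
      obtain ⟨j, hj, hjm⟩ := Finset.exists_min_image (Finset.Icc (p : ℕ) q) c
        ⟨p, by simp; omega⟩
      rw [Finset.mem_Icc] at hj
      have hK : ∀ i : ℕ, p ≤ i → i ≤ q → c j ≤ c i := fun i h1 h2 =>
        hjm i (Finset.mem_Icc.2 ⟨h1, h2⟩)
      have hK' : ∃ i : ℕ, p ≤ i ∧ i ≤ q ∧ c i = c j := ⟨j, hj.1, hj.2, rfl⟩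
      rw [card_typedInvs_rec hpq hp hq hF hK hK', walk_rec q.2 hpq hp hq hF hK hK' (hc j),
        Nat.cast_add, Pi.add_apply,
        ih _ (typeWeight_comp_swap_lt hpq hp hq) _ _ (fun i => ?_) rfl,
        ih _ (typeWeight_setOn_lt hpq hp) _ _ (fun i => ?_) rfl]
      all_goals
        have := hc j
        have := hc i
        rw [setOn]
        split_ifs <;> omega
    · have hF : ∀ j : ℕ, p + 1 ≤ j → j < n → w j = 0 := fun j h1 h2 => by
        have h3 := hmax ⟨j, h2⟩ h1
        have h5 : w j ≠ -1 := fun h => hD ⟨⟨j, h2⟩, h1, h⟩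
        revert h3 h5
        generalize w j = x
        decide +revert
      have h0 : typedInvs n w c = ∅ := by
        rw [Finset.eq_empty_iff_forall_notMem]
        exact fun τ hτ => hD ⟨τ p, (typedInvs_apply_type hτ p).1 hp⟩
      rw [h0, walk_stay (a := p + 1) (by omega) hF, walk_succ, hp]
      simp [restr, move_one]
  · push Not at hU
    by_cases hD : ∃ q : Fin n, w q = -1
    · obtain ⟨q, hq, hmin⟩ : ∃ q : Fin n, w q = -1 ∧ ∀ j : Fin n, j < q → w j ≠ -1 := by
        have hne : (Finset.univ.filter fun q : Fin n => w q = -1).Nonempty := by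
          simpa [Finset.Nonempty] using hD
        refine ⟨_, (Finset.mem_filter.1 (Finset.min'_mem _ hne)).2, fun j hj h => ?_⟩
        exact absurd (Finset.min'_le _ j (by simp [h])) (not_le.2 hj)
      have hF : ∀ j : ℕ, 0 ≤ j → j < q → w j = 0 := fun j _ h2 => by
        have h3 := hU ⟨j, h2.trans q.2⟩
        have h5 := hmin ⟨j, h2.trans q.2⟩ h2
        revert h3 h5
        dsimp only
        generalize w j = x
        decide +revert
      have h0 : typedInvs n w c = ∅ := by
        rw [Finset.eq_empty_iff_forall_notMem]
        exact fun τ hτ => hU (τ q) ((typedInvs_apply_type hτ q).2 hq).2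
      have h1 : walk ℓ w c (q + 1) = 0 := by
        rw [walk_succ, hq]
        have : move ℓ (-1) (restr (c q) (walk ℓ w c q)) = 0 := by
          ext h
          rw [move_neg_one]
          refine Finset.sum_eq_zero fun i _ => ?_
          have hne : h + Pi.single i 1 ≠ 0 := fun H => by
            have := congr_fun H i
            simp at this
          rw [restr, walk_stay (Nat.zero_le _) hF, walk]
          simp [hne]
        rw [this, restr_zero]
      rw [h0, walk_eq_zero (b := n) (by omega) h1]
      simp
    · push Not at hD
      have hF : ∀ j < n, w j = 0 := fun j h2 => by
        have h3 := hU ⟨j, h2⟩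
        have h5 := hD ⟨j, h2⟩
        revert h3 h5
        dsimp only
        generalize w j = x
        decide +revert
      rw [typedInvs_zero_card hF, walk_stay (Nat.zero_le _) fun j _ => hF j, walk]
      simp [isShape_zero_right]

lemma hasDescSeq_of_finset {n k : ℕ} {f : Fin n → Fin n} {B : Finset (Fin n)} (hk : k ≤ B.card)
    (hB : ∀ a ∈ B, ∀ b ∈ B, a < b → f b < f a) : HasDescSeq f k := by
  obtain ⟨C, hCB, hC⟩ := Finset.exists_subset_card_eq hk
  exact ⟨C.orderEmbOfFin hC, (C.orderEmbOfFin hC).strictMono, fun a b hab =>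
    hB _ (hCB (C.orderEmbOfFin_mem hC a)) _ (hCB (C.orderEmbOfFin_mem hC b))
      ((C.orderEmbOfFin hC).strictMono hab)⟩

/-- An involution has a descending subsequence of even length iff it has a nesting of half
that size. -/
lemma hasDescSeq_iff_nestAt {n k : ℕ} {τ : Equiv.Perm (Fin n)} (hτ : Function.Involutive τ)
    (hk : 0 < k) : HasDescSeq τ (2 * k) ↔ ∃ i, NestAt τ i k := by
  constructor
  · rintro ⟨s, hs, hd⟩
    have hd' : ∀ x y, τ (s x) < τ (s y) ↔ y < x := fun x y => hd.lt_iff_gt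
    have hdle : ∀ x y, τ (s x) ≤ τ (s y) ↔ y ≤ x := fun x y => hd.le_iff_ge
    let u : Fin k → Fin (2 * k) := fun x => ⟨x, by omega⟩
    let v : Fin k → Fin (2 * k) := fun x => ⟨k + x, by omega⟩
    have hu : Function.Injective u := fun x y h => by simpa [u, Fin.ext_iff] using h
    have hv : Function.Injective v := fun x y h => by simpa [v, Fin.ext_iff] using h
    let a : Fin (2 * k) := ⟨k - 1, by omega⟩
    let b : Fin (2 * k) := ⟨k, by omega⟩
    have hab : a < b := by simp [a, b]; omega
    have hua : ∀ x, u x ≤ a := fun x => by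
      have := x.2
      simp only [u, a, Fin.mk_le_mk]; omega
    have hvb : ∀ x, b ≤ v x := fun x => by simp [v, b]
    by_cases h : s a < τ (s a)
    · refine ⟨s a, Finset.univ.image (s ∘ u), ?_, ?_, ?_⟩
      · rw [Finset.card_image_of_injective _ (hs.injective.comp hu)]; simp
      · simp only [Finset.mem_image, Finset.mem_univ, true_and, Function.comp_apply]
        rintro _ ⟨x, rfl⟩
        have h1 := hs.monotone (hua x)
        have h2 := (hdle a (u x)).2 (hua x)
        exact ⟨h1, h.le.trans h2, h1.trans_lt (h.trans_le h2)⟩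
      · simp only [Finset.mem_image, Finset.mem_univ, true_and, Function.comp_apply]
        rintro _ ⟨x, rfl⟩ _ ⟨y, rfl⟩ hxy
        exact hd (hs.lt_iff_lt.1 hxy)
    · have h3 : τ (s b) < s b :=
        ((hd hab).trans_le (not_lt.1 h)).trans (hs hab)
      refine ⟨τ (s b), Finset.univ.image (τ ∘ s ∘ v), ?_, ?_, ?_⟩
      · rw [Finset.card_image_of_injective _ (τ.injective.comp (hs.injective.comp hv))]; simp
      · simp only [Finset.mem_image, Finset.mem_univ, true_and, Function.comp_apply]
        rintro _ ⟨x, rfl⟩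
        rw [hτ]
        have h1 := hs.monotone (hvb x)
        have h2 := (hdle (v x) b).2 (hvb x)
        exact ⟨h2, h3.le.trans h1, h2.trans_lt (h3.trans_le h1)⟩
      · simp only [Finset.mem_image, Finset.mem_univ, true_and, Function.comp_apply]
        rintro _ ⟨x, rfl⟩ _ ⟨y, rfl⟩ hxy
        rw [hτ, hτ]
        exact hs ((hd' _ _).1 hxy)
  · rintro ⟨i, A, hA, h1, h2⟩
    have hinv : ∀ x, τ (τ x) = x := hτ
    have hdisj : Disjoint A (A.image τ) := by
      rw [Finset.disjoint_left]
      intro x hx hx'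
      obtain ⟨y, hy, rfl⟩ := Finset.mem_image.1 hx'
      have := (h1 _ hx).2.2
      rw [hinv] at this
      exact lt_asymm this (h1 y hy).2.2
    refine hasDescSeq_of_finset (B := A ∪ A.image τ) ?_ ?_
    · rw [Finset.card_union_of_disjoint hdisj, Finset.card_image_of_injective _ τ.injective]
      omega
    · simp only [Finset.mem_union, Finset.mem_image]
      rintro x (hx | ⟨j, hj, rfl⟩) y (hy | ⟨j', hj', rfl⟩) hxy
      · exact h2 x hx y hy hxy
      · rw [hinv]
        have a1 := h1 x hx
        have a2 := h1 j' hj'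
        refine lt_of_le_of_ne (a2.1.trans a1.2.1) fun h => ?_
        subst h
        rw [hinv] at hxy
        exact lt_irrefl x hxy
      · have a1 := h1 j hj
        have a2 := h1 y hy
        exact absurd hxy (not_lt.2 (a2.1.trans a1.2.1))
      · rw [hinv, hinv]
        rcases lt_trichotomy j j' with h | rfl | h
        · exact absurd hxy (lt_asymm (h2 j hj j' hj' h))
        · exact absurd hxy (lt_irrefl _)
        · exact h

/-- Extend a finite word by zeros. -/
def extendWord {n : ℕ} (w : Fin n → SignType) (j : ℕ) : SignType :=
  if h : j < n then w ⟨j, h⟩ else 0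

lemma invCount_eq_sum (ℓ n : ℕ) : invCount (2 * ℓ + 1) n =
    ∑ w : Fin n → SignType, (typedInvs n (extendWord w) fun _ => ℓ + 1).card := by
  rw [invCount, Nat.card_eq_fintype_card, Fintype.card_subtype,
    Finset.card_eq_sum_card_fiberwise (t := Finset.univ)
      (f := fun τ (i : Fin n) => SignType.sign ((τ i : ℤ) - (i : ℤ))) (by simp)]
  refine Finset.sum_congr rfl fun w _ => congr_arg Finset.card ?_
  ext τ
  simp only [Finset.mem_filter, Finset.mem_univ, true_and, mem_typedInvs, extendWord, Fin.is_lt,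
    dif_pos, funext_iff, Fin.eta]
  constructor
  · rintro ⟨⟨h1, h2⟩, h3⟩
    refine ⟨h1, h3, fun i hi => h2 ((hasDescSeq_iff_nestAt h1 ℓ.succ_pos).2 ⟨i, hi⟩)⟩
  · rintro ⟨h1, h2, h3⟩
    refine ⟨⟨h1, fun h => ?_⟩, h2⟩
    obtain ⟨i, hi⟩ := (hasDescSeq_iff_nestAt h1 ℓ.succ_pos).1 h
    exact h3 i hi

/-- Number of walks of all types on Young diagrams with at most `ℓ` columns. -/
def allWalks (ℓ : ℕ) : ℕ → (ℕ → ℕ) → ℚ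
  | 0 => fun h => if h = 0 then 1 else 0
  | n + 1 => restr (ℓ + 1) (∑ s : SignType, move ℓ s (restr (ℓ + 1) (allWalks ℓ n)))

lemma restr_sum {ι : Type*} (k : ℕ) (s : Finset ι) (f : ι → (ℕ → ℕ) → ℚ) :
    restr k (∑ i ∈ s, f i) = ∑ i ∈ s, restr k (f i) :=
  map_sum (AddMonoidHom.mk' (restr k) (restr_add k)) f s

lemma move_sum {ι : Type*} (ℓ : ℕ) (x : SignType) (s : Finset ι) (f : ι → (ℕ → ℕ) → ℚ) :
    move ℓ x (∑ i ∈ s, f i) = ∑ i ∈ s, move ℓ x (f i) :=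
  map_sum (AddMonoidHom.mk' (move ℓ x) (move_add ℓ x)) f s

lemma sum_walk_eq_allWalks (ℓ n : ℕ) :
    ∑ w : Fin n → SignType, walk ℓ (extendWord w) (fun _ => ℓ + 1) n = allWalks ℓ n := by
  induction n with
  | zero => simp [walk, allWalks]
  | succ n ih =>
    rw [← (Fin.snocEquiv fun _ => SignType).sum_comp, Fintype.sum_prod_type, allWalks, restr_sum]
    refine Finset.sum_congr rfl fun s _ => ?_
    rw [← ih, restr_sum, move_sum, restr_sum]
    refine Finset.sum_congr rfl fun w _ => ?_
    rw [walk_succ]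
    have h1 : extendWord ((Fin.snocEquiv fun _ => SignType) (s, w)) n = s := by
      rw [extendWord, dif_pos n.lt_succ_self]
      exact Fin.snoc_last (α := fun _ => SignType) s w
    rw [h1, walk_congr (w' := extendWord w) (fun j hj => ?_) fun _ _ => rfl]
    rw [extendWord, extendWord, dif_pos hj, dif_pos (by omega)]
    exact Fin.snoc_castSucc (α := fun _ => SignType) s w ⟨j, hj⟩

theorem invCount_eq_allWalks (ℓ n : ℕ) : (invCount (2 * ℓ + 1) n : ℚ) = allWalks ℓ n 0 := by
  rw [invCount_eq_sum, Nat.cast_sum, ← sum_walk_eq_allWalks, Finset.sum_apply]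
  exact Finset.sum_congr rfl fun w _ => card_typedInvs_eq_walk _ _ _ _ fun _ => le_rfl

section BesselDeterminant

open PowerSeries

lemma derivation_prod {R A ι : Type*} [CommSemiring R] [CommSemiring A] [Algebra R A]
    [DecidableEq ι] (D : Derivation R A A) (s : Finset ι) (f : ι → A) :
    D (∏ i ∈ s, f i) = ∑ j ∈ s, ∏ i ∈ s, if i = j then D (f i) else f i := by
  induction s using Finset.induction_on with
  | empty => simp
  | insert a s ha ih =>
    rw [Finset.prod_insert ha, D.leibniz, ih, Finset.sum_insert ha, Finset.prod_insert ha,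
      if_pos rfl, smul_eq_mul, smul_eq_mul, Finset.mul_sum, add_comm]
    congr 1
    · rw [mul_comm]
      congr 1
      exact Finset.prod_congr rfl fun i hi => (if_neg (ne_of_mem_of_not_mem hi ha)).symm
    · refine Finset.sum_congr rfl fun j hj => ?_
      rw [Finset.prod_insert ha, if_neg (ne_of_mem_of_not_mem hj ha).symm]

/-- The derivative of a determinant, column by column. -/
lemma derivation_det {R A ι : Type*} [CommRing R] [CommRing A] [Algebra R A]
    [Fintype ι] [DecidableEq ι] (D : Derivation R A A) (M : Matrix ι ι A) :
    D M.det = ∑ j, (M.updateCol j fun i => D (M i j)).det := by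
  simp_rw [Matrix.det_apply, map_sum, Units.smul_def, map_zsmul, derivation_prod, Finset.smul_sum]
  rw [Finset.sum_comm]
  refine Finset.sum_congr rfl fun j _ => Finset.sum_congr rfl fun σ _ => ?_
  congr 1
  refine Finset.prod_congr rfl fun i _ => ?_
  rw [Matrix.updateCol_apply]
  split_ifs with h
  · rw [h]
  · rfl

/-- The inverse factorial, extended by zero to negative integers. -/
def invFactorial (a : ℤ) : ℚ :=
  if 0 ≤ a then 1 / (Nat.factorial a.toNat : ℚ) else 0

lemma mul_invFactorial (a : ℤ) : a * invFactorial a = invFactorial (a - 1) := by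
  rcases lt_trichotomy a 0 with h | rfl | h
  · rw [invFactorial, invFactorial, if_neg (by omega), if_neg (by omega), mul_zero]
  · simp [invFactorial]
  · obtain ⟨n, rfl⟩ : ∃ n : ℕ, a = n + 1 := ⟨(a - 1).toNat, by omega⟩
    rw [invFactorial, invFactorial, if_pos (by omega), if_pos (by omega), add_sub_cancel_right,
      show ((n : ℤ) + 1).toNat = n + 1 by omega, Int.toNat_natCast, Nat.factorial_succ]
    have : (n.factorial : ℚ) ≠ 0 := by positivity
    push_cast
    field_simp

lemma coeff_besselI (N : ℕ) (i : ℤ) : coeff N (besselI i) =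
    if 2 ∣ (N : ℤ) - i then invFactorial ((N - i) / 2) * invFactorial ((N + i) / 2) else 0 := by
  rw [besselI, coeff_mk]
  by_cases h : 2 ∣ (N : ℤ) - i
  · by_cases h1 : 0 ≤ (N : ℤ) - i
    · by_cases h2 : 0 ≤ (N : ℤ) + i
      · rw [if_pos ⟨h1, h2, h⟩, if_pos h, invFactorial, invFactorial, if_pos (by omega),
          if_pos (by omega), one_div_mul_one_div]
      · rw [if_neg (by tauto), if_pos h, invFactorial, invFactorial,
          if_neg (c := 0 ≤ ((N : ℤ) + i) / 2) (by omega), mul_zero]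
    · rw [if_neg (by tauto), if_pos h, invFactorial, if_neg (by omega), zero_mul]
  · rw [if_neg (by tauto), if_neg h]

lemma derivative_besselI (i : ℤ) :
    derivative ℚ (besselI i) = besselI (i - 1) + besselI (i + 1) := by
  ext n
  rw [coeff_derivative, map_add, coeff_besselI, coeff_besselI, coeff_besselI]
  by_cases h : 2 ∣ ((n + 1 : ℕ) : ℤ) - i
  · obtain ⟨a, ha⟩ := h
    rw [if_pos (by omega), if_pos (by omega), if_pos (by omega),
      show (((n + 1 : ℕ) : ℤ) - i) / 2 = a by omega,
      show (((n + 1 : ℕ) : ℤ) + i) / 2 = a + i by omega,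
      show ((n : ℤ) - (i - 1)) / 2 = a by omega,
      show ((n : ℤ) + (i - 1)) / 2 = a + i - 1 by omega,
      show ((n : ℤ) - (i + 1)) / 2 = a - 1 by omega,
      show ((n : ℤ) + (i + 1)) / 2 = a + i by omega, ← mul_invFactorial, ← mul_invFactorial]
    have : (n : ℚ) + 1 = a + (a + i : ℤ) := by
      have : (n : ℤ) + 1 = a + (a + i) := by omega
      exact_mod_cast this
    rw [this]
    ring
  · rw [if_neg h, if_neg (by omega), if_neg (by omega)]
    simp

lemma constantCoeff_besselI (i : ℤ) : constantCoeff (besselI i) = if i = 0 then 1 else 0 := by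
  rw [← coeff_zero_eq_constantCoeff_apply, coeff_besselI]
  by_cases h : i = 0
  · subst h; simp [invFactorial]
  · rw [if_neg h]
    split_ifs with h2
    · rw [invFactorial, invFactorial]
      split_ifs with h3 h4
      · omega
      all_goals simp
    · rfl

/-- The determinant with columns indexed by the coordinates of `x`. -/
def besselDet (ℓ : ℕ) (x : Fin ℓ → ℤ) : PowerSeries ℚ :=
  Matrix.det (Matrix.of fun a j : Fin ℓ => besselI ((a : ℤ) + 1 - x j) - besselI ((a : ℤ) + 1 + x j))

lemma besselDet_eq_zero_of_eq {ℓ : ℕ} {x : Fin ℓ → ℤ} {j k : Fin ℓ} (hjk : j ≠ k)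
    (h : x j = x k) : besselDet ℓ x = 0 :=
  Matrix.det_zero_of_column_eq hjk fun a => by simp [h]

lemma besselDet_eq_zero_of_zero {ℓ : ℕ} {x : Fin ℓ → ℤ} (j : Fin ℓ)
    (h : x j = 0) : besselDet ℓ x = 0 :=
  Matrix.det_eq_zero_of_column_eq_zero j fun a => by simp [h]

lemma derivative_besselDet (ℓ : ℕ) (x : Fin ℓ → ℤ) :
    derivative ℚ (besselDet ℓ x) =
      ∑ j, (besselDet ℓ (Function.update x j (x j + 1)) +
        besselDet ℓ (Function.update x j (x j - 1))) := by
  rw [besselDet, derivation_det]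
  refine Finset.sum_congr rfl fun j _ => ?_
  have h : (fun a : Fin ℓ => derivative ℚ (besselI ((a : ℤ) + 1 - x j) - besselI ((a : ℤ) + 1 + x j))) =
      (fun a : Fin ℓ => besselI ((a : ℤ) + 1 - (x j + 1)) - besselI ((a : ℤ) + 1 + (x j + 1))) +
      fun a : Fin ℓ => besselI ((a : ℤ) + 1 - (x j - 1)) - besselI ((a : ℤ) + 1 + (x j - 1)) := by
    ext1 a
    rw [Pi.add_apply, map_sub, derivative_besselI, derivative_besselI]
    rw [show (a : ℤ) + 1 - x j - 1 = a + 1 - (x j + 1) by ring,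
      show (a : ℤ) + 1 - x j + 1 = a + 1 - (x j - 1) by ring,
      show (a : ℤ) + 1 + x j - 1 = a + 1 + (x j - 1) by ring,
      show (a : ℤ) + 1 + x j + 1 = a + 1 + (x j + 1) by ring]
    ring
  simp only [Matrix.of_apply]
  rw [h, Matrix.det_updateCol_add]
  congr 1 <;>
  · rw [besselDet]
    congr 1
    ext1 a k
    rw [Matrix.updateCol_apply, Matrix.of_apply, Matrix.of_apply]
    by_cases hk : k = j
    · subst hk; simp
    · simp [hk]

/-- The strictly increasing sequence attached to the column heights `h`. -/
def shapeCoord (ℓ : ℕ) (h : ℕ → ℕ) (j : Fin ℓ) : ℤ := (j : ℤ) + 1 + h (Fin.rev j)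

lemma update_shapeCoord_add (ℓ : ℕ) (h : ℕ → ℕ) (j : Fin ℓ) :
    Function.update (shapeCoord ℓ h) j (shapeCoord ℓ h j + 1) =
      shapeCoord ℓ (h + Pi.single (Fin.rev j : ℕ) 1) := by
  ext k
  by_cases hk : k = j
  · subst hk
    simp [shapeCoord]; ring
  · have : (Fin.rev k : ℕ) ≠ Fin.rev j := fun H => hk (Fin.rev_injective (Fin.ext H))
    rw [Function.update_of_ne hk, shapeCoord, shapeCoord, Pi.add_apply, Pi.single_eq_of_ne this,
      add_zero]

lemma update_shapeCoord_sub {ℓ : ℕ} {h : ℕ → ℕ} {j : Fin ℓ} (hj : 0 < h (Fin.rev j)) :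
    Function.update (shapeCoord ℓ h) j (shapeCoord ℓ h j - 1) =
      shapeCoord ℓ (h - Pi.single (Fin.rev j : ℕ) 1) := by
  ext k
  by_cases hk : k = j
  · subst hk
    rw [Function.update_self, shapeCoord, shapeCoord, Pi.sub_apply, Pi.single_eq_same]
    omega
  · have : (Fin.rev k : ℕ) ≠ Fin.rev j := fun H => hk (Fin.rev_injective (Fin.ext H))
    rw [Function.update_of_ne hk, shapeCoord, shapeCoord, Pi.sub_apply, Pi.single_eq_of_ne this,
      Nat.sub_zero]

lemma besselDet_shape_add {ℓ : ℕ} {h : ℕ → ℕ} (hh : IsShape (ℓ + 1) h) (j : Fin ℓ) :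
    besselDet ℓ (Function.update (shapeCoord ℓ h) j (shapeCoord ℓ h j + 1)) =
      if IsShape (ℓ + 1) (h + Pi.single (Fin.rev j : ℕ) 1) then
        besselDet ℓ (shapeCoord ℓ (h + Pi.single (Fin.rev j : ℕ) 1)) else 0 := by
  rw [update_shapeCoord_add]
  split_ifs with hs
  · rfl
  · rw [isShape_add_iff hh, not_and_or, not_or] at hs
    have h1 := (Fin.rev j).2
    obtain ⟨h2, h3⟩ := hs.resolve_left (not_not.2 h1)
    have h4 : h (Fin.rev j) = h (Fin.rev j - 1) :=
      le_antisymm (hh.1 (Nat.sub_le _ _)) (not_lt.1 h3)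
    have h5 : (j : ℕ) + 1 < ℓ := by rw [Fin.val_rev] at h2; omega
    refine besselDet_eq_zero_of_eq (j := j) (k := ⟨j + 1, h5⟩) (by simp [Fin.ext_iff]) ?_
    have h6 : (Fin.rev ⟨(j : ℕ) + 1, h5⟩ : ℕ) = Fin.rev j - 1 := by
      simp only [Fin.val_rev]; omega
    rw [shapeCoord, shapeCoord, h6, Pi.add_apply, Pi.add_apply, Pi.single_eq_same,
      Pi.single_eq_of_ne (by omega), h4]
    push_cast
    ring

lemma besselDet_shape_sub {ℓ : ℕ} {h : ℕ → ℕ} (hh : IsShape (ℓ + 1) h) (j : Fin ℓ) :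
    besselDet ℓ (Function.update (shapeCoord ℓ h) j (shapeCoord ℓ h j - 1)) =
      if 0 < h (Fin.rev j) ∧ IsShape (ℓ + 1) (h - Pi.single (Fin.rev j : ℕ) 1) then
        besselDet ℓ (shapeCoord ℓ (h - Pi.single (Fin.rev j : ℕ) 1)) else 0 := by
  split_ifs with hs
  · rw [update_shapeCoord_sub hs.1]
  · rw [isShape_sub_iff hh] at hs
    have h4 : h (Fin.rev j) = h (Fin.rev j + 1) :=
      le_antisymm (not_lt.1 hs) (hh.1 (Nat.le_succ _))
    rcases Nat.eq_zero_or_pos (j : ℕ) with hj | hj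
    · refine besselDet_eq_zero_of_zero j ?_
      have h6 : (Fin.rev j : ℕ) + 1 = ℓ := by
        have := j.2
        rw [Fin.val_rev]; omega
      rw [h6, (isShape_succ.1 hh).2] at h4
      rw [Function.update_self, shapeCoord, h4, hj]
      simp
    · have h5 : (j : ℕ) - 1 < ℓ := by omega
      have h6 : (Fin.rev ⟨(j : ℕ) - 1, h5⟩ : ℕ) = Fin.rev j + 1 := by
        have := j.2
        simp only [Fin.val_rev]; omega
      have hne : (⟨(j : ℕ) - 1, h5⟩ : Fin ℓ) ≠ j := by
        rw [Ne, Fin.ext_iff]; dsimp only; omega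
      refine besselDet_eq_zero_of_eq hne ?_
      rw [Function.update_self, Function.update_of_ne hne, shapeCoord, shapeCoord, h6, h4]
      push_cast [Nat.cast_sub hj]
      ring

lemma constantCoeff_besselDet {ℓ : ℕ} {h : ℕ → ℕ} (hh : IsShape (ℓ + 1) h) :
    constantCoeff (besselDet ℓ (shapeCoord ℓ h)) = if h = 0 then 1 else 0 := by
  have hM : constantCoeff (besselDet ℓ (shapeCoord ℓ h)) = Matrix.det
      (Matrix.of fun a j : Fin ℓ => if (a : ℤ) + 1 = shapeCoord ℓ h j then (1 : ℚ) else 0) := by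
    rw [besselDet, RingHom.map_det]
    refine congr_arg Matrix.det ?_
    ext a j
    rw [RingHom.mapMatrix_apply, Matrix.map_apply, Matrix.of_apply, map_sub, constantCoeff_besselI,
      constantCoeff_besselI, Matrix.of_apply, if_neg (c := (a : ℤ) + 1 + shapeCoord ℓ h j = 0)
        (by rw [shapeCoord]; omega), sub_zero]
    exact if_congr sub_eq_zero rfl rfl
  rw [hM]
  split_ifs with h0
  · subst h0
    refine (congr_arg Matrix.det ?_).trans Matrix.det_one
    ext a j
    rw [Matrix.of_apply, Matrix.one_apply]
    refine if_congr ?_ rfl rfl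
    simp [shapeCoord, Fin.ext_iff]
  · have h1 : 0 < h 0 := by
      by_contra H
      refine h0 (funext fun i => ?_)
      have := hh.1 (Nat.zero_le i)
      simp only [Pi.zero_apply]; omega
    have hℓ : 0 < ℓ := by
      rcases Nat.eq_zero_or_pos ℓ with rfl | hℓ
      · have := (isShape_succ.1 hh).2
        omega
      · exact hℓ
    refine Matrix.det_eq_zero_of_column_eq_zero (Fin.rev ⟨0, hℓ⟩) fun a => ?_
    rw [Matrix.of_apply, if_neg]
    rw [shapeCoord, Fin.rev_rev, Fin.val_rev]
    have := a.2
    dsimp only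
    omega

/-- The exponential generating function of walks ending at the shape `h`. -/
def walkSeries (ℓ : ℕ) (h : ℕ → ℕ) : PowerSeries ℚ :=
  (PowerSeries.mk fun n : ℕ => 1 / (Nat.factorial n : ℚ)) * besselDet ℓ (shapeCoord ℓ h)

lemma derivative_exp_series :
    derivative ℚ (PowerSeries.mk fun n : ℕ => 1 / (Nat.factorial n : ℚ)) =
      PowerSeries.mk fun n : ℕ => 1 / (Nat.factorial n : ℚ) := by
  ext n
  rw [coeff_derivative, coeff_mk, coeff_mk, Nat.factorial_succ]
  have : (n.factorial : ℚ) ≠ 0 := by positivity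
  push_cast
  field_simp

lemma derivative_walkSeries {ℓ : ℕ} {h : ℕ → ℕ} (hh : IsShape (ℓ + 1) h) :
    derivative ℚ (walkSeries ℓ h) = walkSeries ℓ h + ∑ i ∈ Finset.range ℓ,
      ((if IsShape (ℓ + 1) (h + Pi.single i 1) then walkSeries ℓ (h + Pi.single i 1) else 0) +
      if 0 < h i ∧ IsShape (ℓ + 1) (h - Pi.single i 1) then walkSeries ℓ (h - Pi.single i 1)
        else 0) := by
  rw [walkSeries, Derivation.leibniz, derivative_exp_series, derivative_besselDet, smul_eq_mul,
    smul_eq_mul, add_comm, mul_comm (besselDet _ _)]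
  congr 1
  rw [Finset.sum_range, ← Equiv.sum_comp Fin.revPerm, Finset.mul_sum]
  refine Finset.sum_congr rfl fun j _ => ?_
  rw [besselDet_shape_add hh, besselDet_shape_sub hh, mul_add, mul_ite, mul_ite, mul_zero, Fin.revPerm_apply,
    Fin.rev_rev]
  rfl

theorem coeff_walkSeries {ℓ : ℕ} (n : ℕ) {h : ℕ → ℕ} (hh : IsShape (ℓ + 1) h) :
    coeff n (walkSeries ℓ h) = allWalks ℓ n h / (Nat.factorial n : ℚ) := by
  induction n generalizing h with
  | zero =>
    rw [coeff_zero_eq_constantCoeff_apply, walkSeries, map_mul, constantCoeff_besselDet hh,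
      allWalks]
    simp
  | succ n ih =>
    have h1 := congr_arg (coeff n) (derivative_walkSeries hh)
    have hn : (n.factorial : ℚ) ≠ 0 := by positivity
    have hn' : (n : ℚ) + 1 ≠ 0 := by positivity
    rw [coeff_derivative, ← eq_div_iff hn'] at h1
    rw [h1, Nat.factorial_succ, Nat.cast_mul, Nat.cast_succ, mul_comm ((n : ℚ) + 1), ← div_div]
    congr 1
    rw [allWalks, restr, if_pos hh, Finset.sum_apply]
    have hu : (Finset.univ : Finset SignType) = {0, -1, 1} := by decide
    rw [hu, Finset.sum_insert (by decide), Finset.sum_insert (by decide), Finset.sum_singleton,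
      move_zero, move_neg_one, move_one, restr, if_pos hh, map_add, ih hh, map_sum,
      ← Finset.sum_add_distrib, add_div, Finset.sum_div]
    congr 1
    refine Finset.sum_congr rfl fun i _ => ?_
    rw [map_add, add_div]
    congr 1
    · rw [restr]
      split_ifs with hs
      · exact ih hs
      · simp
    · rw [restr, ite_and]
      split_ifs with h0 hs
      · exact ih hs
      all_goals simp

end BesselDeterminant

/-- For `m = 2ℓ+1`: `∑_{n≥0} i_n^{(m)} t^n/n! = e^t · det(I_{i−j} − I_{i+j})_{1≤i,j≤ℓ}`.
With 0-based indices `i,j : Fin ℓ`, the entry is `I_{i−j} − I_{i+j+2}`. -/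
theorem invCount_egf_odd (ℓ : ℕ) (hl : 1 ≤ ℓ) :
    (PowerSeries.mk fun n : ℕ =>
        (invCount (2 * ℓ + 1) n : ℚ) / (Nat.factorial n : ℚ))
      = (PowerSeries.mk fun n : ℕ => 1 / (Nat.factorial n : ℚ)) *
        Matrix.det (Matrix.of fun i j : Fin ℓ =>
          besselI ((i : ℤ) - (j : ℤ)) - besselI ((i : ℤ) + (j : ℤ) + 2)) := by
  ext n
  have h := coeff_walkSeries n ((isShape_zero_right (k := ℓ + 1)).2 ℓ.succ_pos)
  rw [PowerSeries.coeff_mk, invCount_eq_allWalks, ← h, walkSeries, besselDet]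
  congr 3
  ext1 i j
  rw [Matrix.of_apply, Matrix.of_apply, shapeCoord]
  congr 2
  · simp
  · simp; ring
end
end
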